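/- arXiv:1210.4215 — 3 statements merged into one kernel-verified Lean document; each statement's English description precedes it below -/
import Mathlib

section
/- Let f satisfy condition (f) with σ := (∫_0^1 f(x)² dx)^{1/2} > 0. Then for any sequence (s_n)_{n≥1} of distinct positive integers, any ξ>0 and any nonempty interval [A,B] ⊂ (1,∞), one has P( x ∈ [A,B] : (σ√N)^{-1} Σ_{n=1}^N f(ξ x^{s_n}) ≤ t ) → Φ(t) as N → ∞, uniformly in t ∈ ℝ, where P is normalized Lebesgue measure on [A,B] and Φ is the standard normal distribution function. -/
open MeasureTheory Filter

/-- The standard normal distribution function. -/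
noncomputable def stdNormalCDF (t : ℝ) : ℝ :=
  ∫ u in Set.Iic t, Real.exp (-u ^ 2 / 2) / Real.sqrt (2 * Real.pi)


/-- splitting for a function with derivative bounded below -/
theorem osc_split (V : ℝ → ℝ → ℝ) (g : ℝ → ℝ) (a b δ ε τ : ℝ) (hab : a ≤ b) (hδ : 0 < δ)
    (hε : 0 < ε) (hτ : 0 ≤ τ)
    (hsub : ∀ x y z, a ≤ x → x ≤ y → y ≤ z → z ≤ b → V x z ≤ V x y + V y z)
    (hlen : ∀ x y, a ≤ x → x ≤ y → y ≤ b → V x y ≤ y - x)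
    (hc : ContinuousOn g (Set.Icc a b))
    (hg : ∀ x y, a ≤ x → x ≤ y → y ≤ b → ε * (y - x) ≤ g y - g x)
    (hV : ∀ x y, a ≤ x → x ≤ y → y ≤ b →
      ((∀ z ∈ Set.Icc x y, δ ≤ g z) ∨ (∀ z ∈ Set.Icc x y, g z ≤ -δ)) → V x y ≤ τ) :
    V a b ≤ 2 * τ + 2 * δ / ε := by
  have hpos : 0 ≤ 2 * δ / ε := by positivity
  have hmono : ∀ x y, a ≤ x → x ≤ y → y ≤ b → g x ≤ g y := fun x y h1 h2 h3 => by
    have := hg x y h1 h2 h3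
    have := mul_nonneg hε.le (sub_nonneg.2 h2)
    linarith
  by_cases h1 : g b ≤ -δ
  · have := hV a b le_rfl hab le_rfl (Or.inr fun z hz =>
      (hmono z b hz.1 hz.2 le_rfl).trans h1)
    linarith
  by_cases h2 : δ ≤ g a
  · have := hV a b le_rfl hab le_rfl (Or.inl fun z hz =>
      h2.trans (hmono a z le_rfl hz.1 hz.2))
    linarith
  push Not at h1 h2
  obtain ⟨c, hac, hcb, hVc, hgc⟩ : ∃ c, a ≤ c ∧ c ≤ b ∧ V a c ≤ τ ∧ -δ ≤ g c ∧ g c < δ := by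
    by_cases h : g a ≤ -δ
    · obtain ⟨c, hc1, hc2⟩ := intermediate_value_Icc hab hc ⟨h, h1.le⟩
      refine ⟨c, hc1.1, hc1.2, ?_, hc2.ge, by linarith⟩
      exact hV a c le_rfl hc1.1 hc1.2 (Or.inr fun z hz =>
        (hmono z c hz.1 hz.2 hc1.2).trans hc2.le)
    · refine ⟨a, le_rfl, hab, ?_, by linarith, h2⟩
      have := hlen a a le_rfl le_rfl hab
      linarith
  obtain ⟨d, hcd, hdb, hVd, hgd⟩ : ∃ d, c ≤ d ∧ d ≤ b ∧ V d b ≤ τ ∧ g d ≤ δ := by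
    by_cases h : δ ≤ g b
    · obtain ⟨d, hd1, hd2⟩ := intermediate_value_Icc hcb
        (hc.mono (Set.Icc_subset_Icc hac le_rfl)) ⟨hgc.2.le, h⟩
      refine ⟨d, hd1.1, hd1.2, ?_, hd2.le⟩
      exact hV d b (hac.trans hd1.1) hd1.2 le_rfl (Or.inl fun z hz =>
        hd2.ge.trans (hmono d z (hac.trans hd1.1) hz.1 hz.2))
    · refine ⟨b, hcb, le_rfl, ?_, by linarith⟩
      have := hlen b b hab le_rfl le_rfl
      linarith
  have e1 := hsub a c b le_rfl hac hcb le_rfl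
  have e2 := hsub c d b hac hcd hdb le_rfl
  have e3 := hlen c d hac hcd hdb
  have e4 := hg c d hac hcd hdb
  have : d - c ≤ 2 * δ / ε := by
    rw [le_div_iff₀ hε]; linarith
  linarith

/-- measure loss -/
noncomputable def oscLoss : ℕ → ℝ → ℝ
  | 0, _ => 0
  | p + 1, δ => 2 ^ (p + 1) * Real.sqrt δ + oscLoss p (Real.sqrt δ)

theorem oscLoss_nonneg (p : ℕ) (δ : ℝ) : 0 ≤ oscLoss p δ := by
  induction p generalizing δ with
  | zero => simp [oscLoss]
  | succ p ih => simp only [oscLoss]; have := ih (Real.sqrt δ); positivity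

theorem osc_sublevel {ι : Type*} [DecidableEq ι] (p : ℕ) (V : ℝ → ℝ → ℝ) (s : Finset ι)
    (hs : s.Nonempty) (hcard : s.card ≤ p) (e : ι → ℕ) (he : Set.InjOn e s) (c : ι → ℝ)
    (hc : ∀ i ∈ s, 1 ≤ |c i|) (a b δ τ : ℝ) (ha : 1 ≤ a) (hab : a ≤ b) (hδ : 0 < δ) (hδ1 : δ ≤ 1)
    (hτ : 0 ≤ τ)
    (hsub : ∀ x y z, a ≤ x → x ≤ y → y ≤ z → z ≤ b → V x z ≤ V x y + V y z)
    (hlen : ∀ x y, a ≤ x → x ≤ y → y ≤ b → V x y ≤ y - x)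
    (hV : ∀ x y, a ≤ x → x ≤ y → y ≤ b →
      ((∀ z ∈ Set.Icc x y, δ ≤ ∑ i ∈ s, c i * z ^ e i) ∨
        (∀ z ∈ Set.Icc x y, ∑ i ∈ s, c i * z ^ e i ≤ -δ)) → V x y ≤ τ) :
    V a b ≤ 2 ^ p * τ + oscLoss p δ := by
  induction p generalizing s e c δ τ with
  | zero => exact absurd (Finset.card_pos.2 hs) (by omega)
  | succ p ih =>
    obtain ⟨i0, hi0, hmin⟩ := s.exists_min_image e hs
    -- Q
    set Q : ℝ → ℝ := fun z => ∑ i ∈ s, c i * z ^ (e i - e i0) with hQ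
    have hPQ : ∀ z : ℝ, ∑ i ∈ s, c i * z ^ e i = z ^ e i0 * Q z := by
      intro z
      rw [hQ, Finset.mul_sum]
      refine Finset.sum_congr rfl fun i hi => ?_
      have : e i = e i0 + (e i - e i0) := by have := hmin i hi; omega
      conv_lhs => rw [this, pow_add]
      ring
    have hVQ : ∀ x y, a ≤ x → x ≤ y → y ≤ b →
      ((∀ z ∈ Set.Icc x y, δ ≤ Q z) ∨ (∀ z ∈ Set.Icc x y, Q z ≤ -δ)) → V x y ≤ τ := by
      intro x y h1 h2 h3 h
      apply hV x y h1 h2 h3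
      refine h.imp (fun h z hz => ?_) (fun h z hz => ?_)
      · rw [hPQ]
        have : (1:ℝ) ≤ z ^ e i0 := one_le_pow₀ (by linarith [hz.1])
        nlinarith [h z hz]
      · rw [hPQ]
        have : (1:ℝ) ≤ z ^ e i0 := one_le_pow₀ (by linarith [hz.1])
        nlinarith [h z hz]
    have hexp : (1:ℝ) ≤ 2 ^ (p+1) := one_le_pow₀ (by norm_num)
    have hloss := oscLoss_nonneg (p+1) δ
    have hQs : ∀ z, Q z = c i0 + ∑ i ∈ s.erase i0, c i * z ^ (e i - e i0) := by
      intro z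
      rw [hQ]
      simp only
      rw [← Finset.add_sum_erase s _ hi0]
      simp
    by_cases hemp : (s.erase i0).Nonempty
    · set c' : ι → ℝ := fun i => c i * ((e i - e i0 : ℕ) : ℝ) with hc'
      set e' : ι → ℕ := fun i => e i - e i0 - 1 with he'
      have hlt : ∀ i ∈ s.erase i0, e i0 < e i := by
        intro i hi
        have h1 := hmin i (Finset.mem_of_mem_erase hi)
        rcases h1.lt_or_eq with h | h
        · exact h
        · exact absurd (he hi0 (Finset.mem_of_mem_erase hi) h).symm (Finset.ne_of_mem_erase hi)
      have hder : ∀ z, HasDerivAt Q (∑ i ∈ s.erase i0, c' i * z ^ e' i) z := by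
        intro z
        have : Q = fun z => c i0 + ∑ i ∈ s.erase i0, c i * z ^ (e i - e i0) := funext hQs
        rw [this]
        have h := HasDerivAt.fun_sum (u := s.erase i0) (A := fun i z => c i * z ^ (e i - e i0))
          (A' := fun i => c' i * z ^ e' i) (x := z) (fun i _ => by
            have := (hasDerivAt_pow (e i - e i0) z).const_mul (c i)
            simpa [hc', he', mul_assoc] using this)
        simpa using h.const_add (c i0)
      have hsq : 0 < Real.sqrt δ := Real.sqrt_pos.2 hδ
      have key := ih (s.erase i0) hemp (by
          rw [Finset.card_erase_of_mem hi0]; omega) e' (by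
          intro i hi j hj hij
          have h1 := hlt i hi
          have h2 := hlt j hj
          apply he (Finset.mem_of_mem_erase hi) (Finset.mem_of_mem_erase hj)
          simp only [he'] at hij
          omega) c' (by
          intro i hi
          rw [hc']
          simp only [abs_mul]
          have h1 := hlt i hi
          have h2 : (1:ℝ) ≤ |((e i - e i0 : ℕ) : ℝ)| := by
            rw [abs_of_nonneg (by positivity)]
            exact_mod_cast (by omega : 1 ≤ e i - e i0)
          have h3 := hc i (Finset.mem_of_mem_erase hi)
          nlinarith) (Real.sqrt δ) (2 * τ + 2 * δ / Real.sqrt δ) hsq (Real.sqrt_le_one.2 hδ1)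
          (by positivity) (by
          intro x y h1 h2 h3 h
          have hcont : Continuous Q := continuous_iff_continuousAt.2 fun z => (hder z).continuousAt
          have hsub' : ∀ u v w, x ≤ u → u ≤ v → v ≤ w → w ≤ y → V u w ≤ V u v + V v w :=
            fun u v w a1 a2 a3 a4 => hsub u v w (h1.trans a1) a2 a3 (a4.trans h3)
          have hlen' : ∀ u v, x ≤ u → u ≤ v → v ≤ y → V u v ≤ v - u :=
            fun u v a1 a2 a3 => hlen u v (h1.trans a1) a2 (a3.trans h3)
          rcases h with h | h
          · refine osc_split V Q x y δ _ τ h2 hδ hsq hτ hsub' hlen' hcont.continuousOn ?_ ?_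
            · intro u v a1 a2 a3
              refine (convex_Icc u v).mul_sub_le_image_sub_of_le_deriv hcont.continuousOn
                (fun z _ => (hder z).differentiableAt.differentiableWithinAt) ?_ u
                (Set.left_mem_Icc.2 a2) v (Set.right_mem_Icc.2 a2) a2
              intro z hz
              rw [(hder z).deriv]
              have := interior_subset hz
              exact h z ⟨a1.trans this.1, this.2.trans a3⟩
            · intro u v a1 a2 a3 hh
              exact hVQ u v (h1.trans a1) a2 (a3.trans h3) hh
          · refine osc_split V (fun z => - Q z) x y δ _ τ h2 hδ hsq hτ hsub' hlen'
              hcont.neg.continuousOn ?_ ?_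
            · intro u v a1 a2 a3
              refine (convex_Icc u v).mul_sub_le_image_sub_of_le_deriv hcont.neg.continuousOn
                (fun z _ => (hder z).neg.differentiableAt.differentiableWithinAt) ?_ u
                (Set.left_mem_Icc.2 a2) v (Set.right_mem_Icc.2 a2) a2
              intro z hz
              have e1 := (hder z).neg.deriv
              rw [e1]
              have := interior_subset hz
              have := h z ⟨a1.trans this.1, this.2.trans a3⟩
              linarith
            · intro u v a1 a2 a3 hh
              refine hVQ u v (h1.trans a1) a2 (a3.trans h3) ?_
              rcases hh with hh | hh
              · exact Or.inr fun z hz => by linarith [hh z hz]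
              · exact Or.inl fun z hz => by linarith [hh z hz])
      refine key.trans (le_of_eq ?_)
      have : δ / Real.sqrt δ = Real.sqrt δ := Real.div_sqrt
      simp only [oscLoss]
      rw [mul_div_assoc, this]
      ring
    · rw [Finset.not_nonempty_iff_eq_empty] at hemp
      have hQc : ∀ z, Q z = c i0 := by intro z; rw [hQs, hemp]; simp
      have h1 := hc i0 hi0
      have : V a b ≤ τ := by
        refine hVQ a b le_rfl hab le_rfl ?_
        rcases le_abs.1 h1 with h | h
        · exact Or.inl fun z _ => by rw [hQc]; linarith
        · exact Or.inr fun z _ => by rw [hQc]; linarith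
      nlinarith

theorem oscLoss_le (p : ℕ) (δ : ℝ) (hδ : 0 < δ) (hδ1 : δ ≤ 1) :
    oscLoss p δ ≤ 2 ^ (p + 1) * δ ^ ((1:ℝ) / 2 ^ p) := by
  induction p generalizing δ with
  | zero => simp only [oscLoss]; positivity
  | succ p ih =>
    simp only [oscLoss]
    have h1 := ih (Real.sqrt δ) (Real.sqrt_pos.2 hδ) (Real.sqrt_le_one.2 hδ1)
    have h2 : (Real.sqrt δ) ^ ((1:ℝ) / 2 ^ p) = δ ^ ((1:ℝ) / 2 ^ (p+1)) := by
      rw [Real.sqrt_eq_rpow, ← Real.rpow_mul hδ.le]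
      congr 1
      field_simp
      ring
    have h3 : Real.sqrt δ ≤ δ ^ ((1:ℝ) / 2 ^ (p+1)) := by
      rw [Real.sqrt_eq_rpow]
      apply Real.rpow_le_rpow_of_exponent_ge hδ hδ1
      apply one_div_le_one_div_of_le (by norm_num)
      calc (2:ℝ) = 2 ^ 1 := by norm_num
        _ ≤ 2 ^ (p+1) := pow_le_pow_right₀ (by norm_num) (by omega)
    rw [h2] at h1
    have h4 : (2:ℝ) ^ (p+1) * Real.sqrt δ ≤ 2 ^ (p+1) * δ ^ ((1:ℝ) / 2 ^ (p+1)) := by gcongr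
    calc _ ≤ 2 ^ (p+1) * δ ^ ((1:ℝ) / 2 ^ (p+1)) + 2 ^ (p+1) * δ ^ ((1:ℝ) / 2 ^ (p+1)) :=
        add_le_add h4 h1
      _ = _ := by ring

/-- first derivative test -/
theorem vdc_first (φ φ' φ'' : ℝ → ℝ) (a b lam : ℝ) (hab : a ≤ b) (hl : 0 < lam)
    (h1 : ∀ x, HasDerivAt φ (φ' x) x) (h2 : ∀ x, HasDerivAt φ' (φ'' x) x)
    (hc : Continuous φ'')
    (hlow : ∀ x ∈ Set.Icc a b, lam ≤ |φ' x|)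
    (hsign : (∀ x ∈ Set.Icc a b, 0 ≤ φ'' x) ∨ (∀ x ∈ Set.Icc a b, φ'' x ≤ 0)) :
    ‖∫ x in a..b, Complex.exp (Complex.I * φ x)‖ ≤ 4 / lam := by
  have hc1 : Continuous φ' := continuous_iff_continuousAt.2 fun x => (h2 x).continuousAt
  have hc0 : Continuous φ := continuous_iff_continuousAt.2 fun x => (h1 x).continuousAt
  have hne : ∀ x ∈ Set.Icc a b, φ' x ≠ 0 := fun x hx h => by
    have := hlow x hx
    rw [h, abs_zero] at this
    linarith
  have huIcc : Set.uIcc a b = Set.Icc a b := Set.uIcc_of_le hab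
  have hinv : ∀ x ∈ Set.Icc a b, |(φ' x)⁻¹| ≤ 1 / lam := fun x hx => by
    rw [abs_inv, ← one_div]
    exact one_div_le_one_div_of_le hl (hlow x hx)
  have hdinv : ∀ x ∈ Set.Icc a b, HasDerivAt (fun x => (φ' x)⁻¹) (-φ'' x / φ' x ^ 2) x :=
    fun x hx => (h2 x).fun_inv (hne x hx)
  have hcd : ContinuousOn (fun x => -φ'' x / φ' x ^ 2) (Set.Icc a b) :=
    ContinuousOn.div hc.neg.continuousOn (hc1.pow 2).continuousOn
      (fun x hx => pow_ne_zero 2 (hne x hx))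
  -- u = 1/φ', v = exp(iφ)
  have hv : ∀ x, HasDerivAt (fun x => Complex.exp (Complex.I * φ x))
      (Complex.exp (Complex.I * φ x) * (Complex.I * φ' x)) x := fun x =>
    (((h1 x).ofReal_comp).const_mul Complex.I).cexp
  have hu : ∀ x ∈ Set.Icc a b, HasDerivAt (fun x => (((φ' x)⁻¹ : ℝ) : ℂ))
      (((-φ'' x / φ' x ^ 2 : ℝ)) : ℂ) x := fun x hx => (hdinv x hx).ofReal_comp
  have hcdC : ContinuousOn (fun x => ((-φ'' x / φ' x ^ 2 : ℝ) : ℂ)) (Set.Icc a b) :=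
    Complex.continuous_ofReal.comp_continuousOn hcd
  have hcv : Continuous fun x => Complex.exp (Complex.I * φ x) := by fun_prop
  have ibp := intervalIntegral.integral_mul_deriv_eq_deriv_mul (a := a) (b := b)
    (u := fun x => (((φ' x)⁻¹ : ℝ) : ℂ)) (v := fun x => Complex.exp (Complex.I * φ x))
    (u' := fun x => ((-φ'' x / φ' x ^ 2 : ℝ) : ℂ))
    (v' := fun x => Complex.exp (Complex.I * φ x) * (Complex.I * φ' x))
    (fun x hx => hu x (huIcc ▸ hx)) (fun x _ => hv x)
    (by apply ContinuousOn.intervalIntegrable; rwa [huIcc])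
    (by apply Continuous.intervalIntegrable; fun_prop)
  have hEq : (∫ x in a..b, (((φ' x)⁻¹ : ℝ) : ℂ) *
      (Complex.exp (Complex.I * φ x) * (Complex.I * φ' x))) =
      Complex.I * ∫ x in a..b, Complex.exp (Complex.I * φ x) := by
    rw [← intervalIntegral.integral_const_mul]
    apply intervalIntegral.integral_congr
    intro x hx
    have := hne x (huIcc ▸ hx)
    have h' : (φ' x : ℂ) ≠ 0 := by exact_mod_cast this
    simp only [Complex.ofReal_inv]
    field_simp
  have hnorm : ‖∫ x in a..b, Complex.exp (Complex.I * φ x)‖ =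
      ‖∫ x in a..b, (((φ' x)⁻¹ : ℝ) : ℂ) *
      (Complex.exp (Complex.I * φ x) * (Complex.I * φ' x))‖ := by
    rw [hEq, norm_mul, Complex.norm_I, one_mul]
  rw [hnorm, ibp]
  have hexp : ∀ x : ℝ, ‖Complex.exp (Complex.I * φ x)‖ = 1 := fun x => by
    rw [mul_comm]; exact Complex.norm_exp_ofReal_mul_I _
  have hFTC : ∫ x in a..b, -φ'' x / φ' x ^ 2 = (φ' b)⁻¹ - (φ' a)⁻¹ := by
    apply intervalIntegral.integral_eq_sub_of_hasDerivAt
    · intro x hx; exact hdinv x (huIcc ▸ hx)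
    · apply ContinuousOn.intervalIntegrable; rwa [huIcc]
  have hb1 := hinv a (Set.left_mem_Icc.2 hab)
  have hb2 := hinv b (Set.right_mem_Icc.2 hab)
  have hint : ‖∫ x in a..b, ((-φ'' x / φ' x ^ 2 : ℝ) : ℂ) * Complex.exp (Complex.I * φ x)‖
      ≤ 2 / lam := by
    calc _ ≤ ∫ x in a..b, ‖((-φ'' x / φ' x ^ 2 : ℝ) : ℂ) * Complex.exp (Complex.I * φ x)‖ :=
          intervalIntegral.norm_integral_le_integral_norm hab
      _ = ∫ x in a..b, |-φ'' x / φ' x ^ 2| := by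
          congr 1; ext x
          rw [norm_mul, hexp, mul_one, Complex.norm_real, Real.norm_eq_abs]
      _ = |∫ x in a..b, -φ'' x / φ' x ^ 2| := by
          have hnn : 0 ≤ ∫ x in a..b, |-φ'' x / φ' x ^ 2| :=
            intervalIntegral.integral_nonneg hab fun x _ => abs_nonneg _
          rcases hsign with h | h
          · have hn : ∀ x ∈ Set.uIcc a b, |-φ'' x / φ' x ^ 2| = - (-φ'' x / φ' x ^ 2) := by
              intro x hx
              apply abs_of_nonpos
              apply div_nonpos_of_nonpos_of_nonneg _ (sq_nonneg _)
              linarith [h x (huIcc ▸ hx)]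
            rw [intervalIntegral.integral_congr hn, intervalIntegral.integral_neg] at hnn ⊢
            exact (abs_of_nonpos (by linarith)).symm
          · have hn : ∀ x ∈ Set.uIcc a b, |-φ'' x / φ' x ^ 2| = (-φ'' x / φ' x ^ 2) := by
              intro x hx
              apply abs_of_nonneg
              apply div_nonneg _ (sq_nonneg _)
              linarith [h x (huIcc ▸ hx)]
            rw [intervalIntegral.integral_congr hn] at hnn ⊢
            exact (abs_of_nonneg hnn).symm
      _ ≤ 2 / lam := by
          rw [hFTC]
          calc _ ≤ |(φ' b)⁻¹| + |(φ' a)⁻¹| := abs_sub _ _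
            _ ≤ 1 / lam + 1 / lam := add_le_add hb2 hb1
            _ = _ := by ring
  have hbd : ∀ x ∈ Set.Icc a b, ‖(((φ' x)⁻¹ : ℝ) : ℂ) * Complex.exp (Complex.I * φ x)‖ ≤ 1 / lam := by
    intro x hx
    rw [norm_mul, hexp, mul_one, Complex.norm_real, Real.norm_eq_abs]
    exact hinv x hx
  calc _ ≤ ‖(((φ' b)⁻¹ : ℝ) : ℂ) * Complex.exp (Complex.I * φ b)‖ +
        ‖(((φ' a)⁻¹ : ℝ) : ℂ) * Complex.exp (Complex.I * φ a)‖ +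
        ‖∫ x in a..b, ((-φ'' x / φ' x ^ 2 : ℝ) : ℂ) * Complex.exp (Complex.I * φ x)‖ :=
        (norm_sub_le _ _).trans (by gcongr; exact norm_sub_le _ _)
    _ ≤ 1 / lam + 1 / lam + 2 / lam := by
        gcongr
        · exact hbd b (Set.right_mem_Icc.2 hab)
        · exact hbd a (Set.left_mem_Icc.2 hab)
    _ = 4 / lam := by ring


theorem osc_bound (p : ℕ) (ξ A B : ℝ) (hξ : 0 < ξ) (hA : 1 < A) (hAB : A < B) :
    ∃ C q : ℝ, 0 ≤ C ∧ 0 < q ∧ q < 1 ∧ ∀ K : ℕ, 2 ≤ K → ∀ (ι : Type) [DecidableEq ι] (s : Finset ι)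
      (e : ι → ℕ) (c : ι → ℝ), s.Nonempty → s.card ≤ p → Set.InjOn e s → (∀ i ∈ s, K ≤ e i) →
      (∀ i ∈ s, 1 ≤ |c i|) →
      ‖∫ x in A..B, Complex.exp (Complex.I * ((2 * Real.pi * ξ * ∑ i ∈ s, c i * x ^ e i : ℝ) : ℂ))‖
        ≤ C * q ^ K := by
  set a := Real.sqrt A with ha
  have ha2 : a ^ 2 = A := Real.sq_sqrt (by linarith)
  have ha1 : 1 < a := by rw [ha, Real.lt_sqrt (by norm_num)]; simpa using hA
  set r := a⁻¹ with hr
  have hr0 : 0 < r := by positivity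
  have hr1 : r < 1 := inv_lt_one_of_one_lt₀ ha1
  have hpi := Real.pi_pos
  set q := r ^ ((1:ℝ) / 2 ^ p) with hq
  have hq0 : 0 < q := Real.rpow_pos_of_pos hr0 _
  have hq1 : q < 1 := Real.rpow_lt_one hr0.le hr1 (by positivity)
  have hrq : r ≤ q := by
    conv_lhs => rw [← Real.rpow_one r]
    apply Real.rpow_le_rpow_of_exponent_ge hr0 hr1.le
    rw [div_le_one (by positivity)]
    exact one_le_pow₀ (by norm_num)
  refine ⟨2 ^ p * (2 ^ p * (2 * A / (Real.pi * ξ)) + 2 ^ (p+1)) + 2 ^ (p+1), q, by positivity,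
    hq0, hq1, ?_⟩
  intro K hK ι _ s e c hs hcard he heK hc
  set δ := r ^ K with hδ
  have hδ0 : 0 < δ := by positivity
  have hδ1 : δ ≤ 1 := pow_le_one₀ hr0.le hr1.le
  set lam := 2 * Real.pi * ξ * (δ * A ^ (K - 1)) with hlam
  have hlam0 : 0 < lam := by positivity
  set φ : ℝ → ℝ := fun x => 2 * Real.pi * ξ * ∑ i ∈ s, c i * x ^ e i with hφ
  set φ' : ℝ → ℝ := fun x => 2 * Real.pi * ξ * ∑ i ∈ s, c i * (e i * x ^ (e i - 1)) with hφ'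
  set φ'' : ℝ → ℝ := fun x => 2 * Real.pi * ξ * ∑ i ∈ s, (c i * (e i * (e i - 1 : ℕ))) * x ^ (e i - 2)
    with hφ''
  have h1 : ∀ x, HasDerivAt φ (φ' x) x := fun x => by
    apply HasDerivAt.const_mul
    apply HasDerivAt.fun_sum
    intro i _
    exact (hasDerivAt_pow (e i) x).const_mul (c i)
  have h2 : ∀ x, HasDerivAt φ' (φ'' x) x := fun x => by
    apply HasDerivAt.const_mul
    apply HasDerivAt.fun_sum
    intro i _
    have := ((hasDerivAt_pow (e i - 1) x).const_mul (e i : ℝ)).const_mul (c i)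
    have h3 : e i - 1 - 1 = e i - 2 := by omega
    rw [h3] at this
    refine this.congr_deriv ?_
    ring
  have hcφ : Continuous φ := by fun_prop
  have hcφ'' : Continuous φ'' := by fun_prop
  have hcE : Continuous fun x => Complex.exp (Complex.I * (φ x : ℂ)) := by fun_prop
  set V : ℝ → ℝ → ℝ := fun x y => ‖∫ t in x..y, Complex.exp (Complex.I * (φ t : ℂ))‖ with hVdef
  have hsub : ∀ x y z, V x z ≤ V x y + V y z := by
    intro x y z
    simp only [hVdef]
    rw [← intervalIntegral.integral_add_adjacent_intervals (hcE.intervalIntegrable x y)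
      (hcE.intervalIntegrable y z)]
    exact norm_add_le _ _
  have hlen : ∀ x y, x ≤ y → V x y ≤ y - x := by
    intro x y hxy
    have := intervalIntegral.norm_integral_le_of_norm_le_const (a := x) (b := y) (C := 1)
      (f := fun t => Complex.exp (Complex.I * (φ t : ℂ))) (fun t _ => by
        rw [mul_comm, Complex.norm_exp_ofReal_mul_I])
    rwa [one_mul, abs_of_nonneg (sub_nonneg.2 hxy)] at this
  set τ := 4 / lam with hτ
  have hτ0 : 0 ≤ τ := by positivity
  have hL0 := oscLoss_nonneg p δ
  set L := oscLoss p δ with hL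
  have main : V A B ≤ 2 ^ p * (2 ^ p * τ + L) + L := by
    refine osc_sublevel p V s hs hcard (fun i => e i - K) ?_ (fun i => c i * e i) ?_ A B δ
      (2 ^ p * τ + L) hA.le hAB.le hδ0 hδ1 (by positivity) (fun x y z _ _ _ _ => hsub x y z)
      (fun x y _ h _ => hlen x y h) ?_
    · intro i hi j hj hij
      have := heK i hi
      have := heK j hj
      apply he hi hj
      simp only at hij
      omega
    · intro i hi
      rw [abs_mul]
      have h3 := hc i hi
      have h4 : (1:ℝ) ≤ |(e i : ℝ)| := by
        rw [abs_of_nonneg (by positivity)]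
        have := heK i hi
        exact_mod_cast (by omega : 1 ≤ e i)
      nlinarith
    · intro x y hx hxy hy hR
      refine osc_sublevel p V s hs hcard (fun i => e i - 2) ?_
        (fun i => c i * (e i * (e i - 1 : ℕ))) ?_ x y δ
        τ (hA.le.trans hx) hxy hδ0 hδ1 hτ0 (fun x y z _ _ _ _ => hsub x y z)
        (fun x y _ h _ => hlen x y h) ?_
      · intro i hi j hj hij
        have := heK i hi
        have := heK j hj
        apply he hi hj
        simp only at hij
        omega
      · intro i hi
        rw [abs_mul]
        have h3 := hc i hi
        have h4 : (1:ℝ) ≤ |(e i * (e i - 1 : ℕ) : ℝ)| := by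
          rw [abs_of_nonneg (by positivity)]
          have := heK i hi
          have h5 : 1 ≤ e i * (e i - 1) := Nat.mul_pos (by omega) (by omega)
          exact_mod_cast h5
        nlinarith
      · intro u v hu huv hv hsg
        refine vdc_first φ φ' φ'' u v lam huv hlam0 h1 h2 hcφ'' ?_ ?_
        · intro z hz
          have hzA : A ≤ z := by linarith [hz.1]
          have hfac : φ' z = 2 * Real.pi * ξ * (z ^ (K - 1) * ∑ i ∈ s, c i * e i * z ^ (e i - K)) := by
            simp only [hφ']
            congr 1
            rw [Finset.mul_sum]
            apply Finset.sum_congr rfl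
            intro i hi
            have : e i - 1 = (K - 1) + (e i - K) := by have := heK i hi; omega
            rw [this, pow_add]; ring
          have hRz : δ ≤ |∑ i ∈ s, c i * e i * z ^ (e i - K)| := by
            have hz' : z ∈ Set.Icc x y := ⟨hu.trans hz.1, hz.2.trans hv⟩
            rcases hR with h | h
            · exact (h z hz').trans (le_abs_self _)
            · rw [le_abs]; right; have := h z hz'; linarith
          rw [hfac, abs_mul, abs_of_pos (by positivity : 0 < 2 * Real.pi * ξ), hlam, abs_mul]
          apply mul_le_mul_of_nonneg_left _ (by positivity)
          rw [mul_comm]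
          apply mul_le_mul _ hRz hδ0.le (abs_nonneg _)
          rw [abs_of_nonneg (by apply pow_nonneg; linarith)]
          exact pow_le_pow_left₀ (by linarith) hzA _
        · refine hsg.imp (fun h z hz => ?_) (fun h z hz => ?_)
          · have := h z hz
            exact mul_nonneg (by positivity) (hδ0.le.trans this)
          · have := h z hz
            exact mul_nonpos_of_nonneg_of_nonpos (by positivity) (this.trans (by linarith))
  have hδq : δ ^ ((1:ℝ) / 2 ^ p) = q ^ K := by
    rw [hδ, hq, ← Real.rpow_natCast r K, ← Real.rpow_natCast _ K, ← Real.rpow_mul hr0.le,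
      ← Real.rpow_mul hr0.le, mul_comm]
  have hLle : L ≤ 2 ^ (p+1) * q ^ K := by
    rw [← hδq]; exact oscLoss_le p δ hδ0 hδ1
  have hτle : τ ≤ 2 * A / (Real.pi * ξ) * q ^ K := by
    have e1 : A ^ K * δ * δ = 1 := by
      rw [hδ, ← ha2, ← pow_mul, mul_comm 2 K, pow_mul, hr]
      have : a ^ K ≠ 0 := by positivity
      rw [inv_pow]
      field_simp
    have e2 : A ^ K = A * A ^ (K-1) := by
      rw [← pow_succ']; congr 1; omega
    have : τ = 2 * A / (Real.pi * ξ) * δ := by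
      rw [hτ, hlam]
      rw [e2] at e1
      field_simp
      linear_combination (-4) * e1
    rw [this]
    gcongr
    exact pow_le_pow_left₀ hr0.le hrq K
  calc V A B ≤ _ := main
    _ ≤ 2 ^ p * (2 ^ p * (2 * A / (Real.pi * ξ) * q ^ K) + 2 ^ (p+1) * q ^ K) + 2 ^ (p+1) * q ^ K := by
        gcongr
    _ = _ := by ring


theorem cexp_taylor_nonneg (M : ℕ) (x : ℝ) (hx : 0 ≤ x) :
    ‖Complex.exp (Complex.I * x) - ∑ m ∈ Finset.range M, (Complex.I * x) ^ m / m.factorial‖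
      ≤ x ^ M / M.factorial := by
  induction M generalizing x with
  | zero => simp [mul_comm Complex.I, Complex.norm_exp_ofReal_mul_I]
  | succ M ih =>
    set F : ℝ → ℂ := fun x => Complex.exp (Complex.I * x) -
      ∑ m ∈ Finset.range (M+1), (Complex.I * x) ^ m / m.factorial with hF
    set F' : ℝ → ℂ := fun x => Complex.I * (Complex.exp (Complex.I * x) -
      ∑ m ∈ Finset.range M, (Complex.I * x) ^ m / m.factorial) with hF'
    have hder : ∀ x, HasDerivAt F (F' x) x := by
      intro x
      have h0 : HasDerivAt (fun x : ℝ => Complex.I * (x:ℂ)) Complex.I x := by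
        simpa using (Complex.ofRealCLM.hasDerivAt (x := x)).const_mul Complex.I
      have h1 := h0.cexp
      have h2 : HasDerivAt (fun x : ℝ => ∑ m ∈ Finset.range (M+1), (Complex.I * x) ^ m / m.factorial)
          (∑ m ∈ Finset.range (M+1), (m * (Complex.I * x) ^ (m-1) * Complex.I) / m.factorial) x := by
        apply HasDerivAt.fun_sum
        intro m _
        exact (h0.fun_pow m).div_const _
      refine (h1.sub h2).congr_deriv ?_
      rw [Finset.sum_range_succ']
      simp only [hF', Nat.cast_zero, zero_mul, zero_div, add_zero, mul_sub, Finset.mul_sum]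
      congr 1
      · ring
      · apply Finset.sum_congr rfl
        intro m _
        rw [Nat.factorial_succ]
        have : (m.factorial : ℂ) ≠ 0 := by exact_mod_cast m.factorial_ne_zero
        have h3 : ((m : ℂ) + 1) ≠ 0 := by exact_mod_cast m.succ_ne_zero
        push_cast
        field_simp
    have hB : ∀ x : ℝ, HasDerivAt (fun x : ℝ => x ^ (M+1) / (M+1).factorial) (x ^ M / M.factorial) x := by
      intro x
      refine ((hasDerivAt_pow (M+1) x).div_const _).congr_deriv ?_
      rw [Nat.factorial_succ]
      have : (M.factorial : ℝ) ≠ 0 := by exact_mod_cast M.factorial_ne_zero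
      push_cast
      field_simp
    refine image_norm_le_of_norm_deriv_right_le_deriv_boundary (f := F) (f' := F') (a := 0) (b := x)
      (fun z _ => (hder z).continuousAt.continuousWithinAt) (fun z _ => (hder z).hasDerivWithinAt)
      ?_ hB ?_ ⟨hx, le_rfl⟩
    · simp [hF, Finset.sum_range_succ']
    · intro z hz
      simp only [hF', norm_mul, Complex.norm_I, one_mul]
      exact ih z hz.1

theorem cexp_taylor (M : ℕ) (x : ℝ) :
    ‖Complex.exp (Complex.I * x) - ∑ m ∈ Finset.range M, (Complex.I * x) ^ m / m.factorial‖
      ≤ |x| ^ M / M.factorial := by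
  rcases le_total 0 x with h | h
  · rw [abs_of_nonneg h]; exact cexp_taylor_nonneg M x h
  · rw [abs_of_nonpos h]
    have := cexp_taylor_nonneg M (-x) (by linarith)
    rw [← Complex.norm_conj] at this
    simpa [← Complex.exp_conj, map_sum] using this

theorem integrable_of_bdd {Ω : Type*} [MeasurableSpace Ω] {E : Type*} [NormedAddCommGroup E]
    (μ : Measure Ω) [IsFiniteMeasure μ]
    (f : Ω → E) (hf : AEStronglyMeasurable f μ) (C : ℝ) (h : ∀ x, ‖f x‖ ≤ C) : Integrable f μ :=
  Integrable.of_bound hf C (Eventually.of_forall h)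

theorem char_cmp {Ω₁ Ω₂ : Type} [MeasurableSpace Ω₁] [MeasurableSpace Ω₂]
    (μ : Measure Ω₁) (ν : Measure Ω₂) [IsProbabilityMeasure μ] [IsProbabilityMeasure ν]
    (X : Ω₁ → ℝ) (Z : Ω₂ → ℝ) (hX : Measurable X) (hZ : Measurable Z) (C : ℝ)
    (hXC : ∀ ω, |X ω| ≤ C) (hZC : ∀ ω, |Z ω| ≤ C) (M : ℕ) (hM : Even M) (η : ℝ)
    (hη : ∀ m ≤ M, |(∫ ω, X ω ^ m ∂μ) - ∫ ω, Z ω ^ m ∂ν| ≤ η) :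
    ‖(∫ ω, Complex.exp (Complex.I * X ω) ∂μ) - ∫ ω, Complex.exp (Complex.I * Z ω) ∂ν‖
      ≤ (M + 1) * η + 2 * (2⁻¹ ^ M * ((∫ ω, Real.exp (2 * Z ω) ∂ν) + ∫ ω, Real.exp (- (2 * Z ω)) ∂ν)) := by
  have gen : ∀ {Ω : Type} [MeasurableSpace Ω] (μ : Measure Ω) [IsProbabilityMeasure μ] (X : Ω → ℝ)
      (_ : Measurable X) (_ : ∀ ω, |X ω| ≤ C),
      ‖(∫ ω, Complex.exp (Complex.I * X ω) ∂μ) -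
        ∑ m ∈ Finset.range M, Complex.I ^ m / m.factorial * ((∫ ω, X ω ^ m ∂μ : ℝ) : ℂ)‖ ≤
        (∫ ω, X ω ^ M ∂μ) / M.factorial := by
    intro Ω _ μ _ X hX hXC
    have hpow : ∀ m, Integrable (fun ω => X ω ^ m) μ := fun m =>
      integrable_of_bdd μ _ (hX.pow_const m).aestronglyMeasurable (C ^ m) fun ω => by
        rw [norm_pow]; exact pow_le_pow_left₀ (norm_nonneg _) (hXC ω) m
    have hexp : Integrable (fun ω => Complex.exp (Complex.I * X ω)) μ :=
      integrable_of_bdd μ _ (by fun_prop) 1 fun ω => by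
        rw [mul_comm, Complex.norm_exp_ofReal_mul_I]
    have hterm : ∀ m ∈ Finset.range M, Integrable (fun ω => (Complex.I * X ω) ^ m / m.factorial) μ := by
      intro m _
      have := ((hpow m).ofReal (𝕜 := ℂ)).const_mul (Complex.I ^ m / m.factorial)
      refine this.congr (Eventually.of_forall fun ω => ?_)
      change _ * ((X ω ^ m : ℝ) : ℂ) = _
      push_cast
      rw [mul_pow]
      ring
    have e1 : ∑ m ∈ Finset.range M, Complex.I ^ m / m.factorial * ((∫ ω, X ω ^ m ∂μ : ℝ) : ℂ) =
        ∫ ω, ∑ m ∈ Finset.range M, (Complex.I * X ω) ^ m / m.factorial ∂μ := by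
      rw [integral_finsetSum _ hterm]
      apply Finset.sum_congr rfl
      intro m _
      rw [← integral_complex_ofReal, ← integral_const_mul]
      congr 1; ext ω
      rw [mul_pow]; push_cast; ring
    rw [e1, ← integral_sub hexp (integrable_finsetSum _ hterm), ← integral_div]
    refine norm_integral_le_of_norm_le ((hpow M).div_const _) (Eventually.of_forall fun ω => ?_)
    have := cexp_taylor M (X ω)
    rwa [hM.pow_abs] at this
  have hη0 : 0 ≤ η := (abs_nonneg _).trans (hη 0 (Nat.zero_le _))
  have a1 := gen μ X hX hXC
  have a2 := gen ν Z hZ hZC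
  have a3 : ‖(∑ m ∈ Finset.range M, Complex.I ^ m / m.factorial * ((∫ ω, X ω ^ m ∂μ : ℝ) : ℂ)) -
      ∑ m ∈ Finset.range M, Complex.I ^ m / m.factorial * ((∫ ω, Z ω ^ m ∂ν : ℝ) : ℂ)‖ ≤ M * η := by
    rw [← Finset.sum_sub_distrib]
    refine (norm_sum_le_of_le (f := _) (n := fun _ => η) _ ?_).trans (by simp)
    intro m hm
    rw [← mul_sub, ← Complex.ofReal_sub, norm_mul, Complex.norm_real, norm_div, norm_pow,
      Complex.norm_I, one_pow, Real.norm_eq_abs]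
    have h1 := hη m (Finset.mem_range.1 hm).le
    have h2 : 1 / ‖(m.factorial : ℂ)‖ ≤ 1 := by
      rw [Complex.norm_natCast, div_le_one (by exact_mod_cast m.factorial_pos)]
      exact_mod_cast m.factorial_pos
    calc _ ≤ 1 * η := mul_le_mul h2 h1 (abs_nonneg _) zero_le_one
      _ = η := one_mul _
  have a4 : (∫ ω, X ω ^ M ∂μ) / M.factorial ≤ η + (∫ ω, Z ω ^ M ∂ν) / M.factorial := by
    have h1 := (abs_le.1 (hη M le_rfl)).2
    have h2 : (1:ℝ) ≤ M.factorial := by exact_mod_cast M.factorial_pos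
    have h3 : η / M.factorial ≤ η := div_le_self hη0 h2
    calc _ ≤ (η + ∫ ω, Z ω ^ M ∂ν) / M.factorial := by gcongr; linarith
      _ ≤ _ := by rw [add_div]; linarith
  have a5 : (∫ ω, Z ω ^ M ∂ν) / M.factorial ≤
      2⁻¹ ^ M * ((∫ ω, Real.exp (2 * Z ω) ∂ν) + ∫ ω, Real.exp (- (2 * Z ω)) ∂ν) := by
    have hC : ∀ ω, |2 * Z ω| ≤ 2 * C := fun ω => by rw [abs_mul]; simpa using hZC ω
    have i1 : Integrable (fun ω => Real.exp (2 * Z ω)) ν :=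
      integrable_of_bdd ν _ (by fun_prop) (Real.exp (2 * C)) fun ω => by
        rw [Real.norm_eq_abs, Real.abs_exp]
        exact Real.exp_le_exp.2 ((le_abs_self _).trans (hC ω))
    have i2 : Integrable (fun ω => Real.exp (-(2 * Z ω))) ν :=
      integrable_of_bdd ν _ (by fun_prop) (Real.exp (2 * C)) fun ω => by
        rw [Real.norm_eq_abs, Real.abs_exp]
        exact Real.exp_le_exp.2 ((neg_le_abs _).trans (hC ω))
    rw [← integral_add i1 i2, ← integral_const_mul, ← integral_div]
    refine integral_mono_of_nonneg (Eventually.of_forall fun ω => ?_) ((i1.add i2).const_mul _)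
      (Eventually.of_forall fun ω => ?_)
    · have := hM.pow_nonneg (Z ω); simp only [Pi.zero_apply]; positivity
    · have h1 := Real.pow_div_factorial_le_exp (|2 * Z ω|) (abs_nonneg _) M
      rw [hM.pow_abs] at h1
      have h2 : Real.exp |2 * Z ω| ≤ Real.exp (2 * Z ω) + Real.exp (-(2 * Z ω)) := by
        rcases abs_choice (2 * Z ω) with h | h <;> rw [h] <;>
          [linarith [Real.exp_pos (-(2 * Z ω))]; linarith [Real.exp_pos ((2 * Z ω))]]
      calc Z ω ^ M / M.factorial = 2⁻¹ ^ M * ((2 * Z ω) ^ M / M.factorial) := by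
            rw [mul_pow, inv_pow]; field_simp
        _ ≤ _ := by
            simp only [Pi.add_apply]
            exact mul_le_mul_of_nonneg_left (h1.trans h2) (by positivity)
  set S1 := ∑ m ∈ Finset.range M, Complex.I ^ m / m.factorial * ((∫ ω, X ω ^ m ∂μ : ℝ) : ℂ)
  set S2 := ∑ m ∈ Finset.range M, Complex.I ^ m / m.factorial * ((∫ ω, Z ω ^ m ∂ν : ℝ) : ℂ)
  set E1 := ∫ ω, Complex.exp (Complex.I * X ω) ∂μ
  set E2 := ∫ ω, Complex.exp (Complex.I * Z ω) ∂ν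
  have a6 : ‖E1 - E2‖ ≤ ‖E1 - S1‖ + ‖S1 - S2‖ + ‖E2 - S2‖ := by
    have : E1 - E2 = (E1 - S1) + (S1 - S2) - (E2 - S2) := by ring
    rw [this]
    exact (norm_sub_le _ _).trans (by gcongr; exact norm_add_le _ _)
  nlinarith


noncomputable def tchi {ι : Type} [Fintype ι] (w : ι → ℤ) (y : ι → ℝ) : ℂ :=
  Complex.exp (Complex.I * ((2 * Real.pi * ∑ k, (w k : ℝ) * y k : ℝ) : ℂ))

theorem tchi_norm {ι : Type} [Fintype ι] (w : ι → ℤ) (y : ι → ℝ) : ‖tchi w y‖ = 1 := by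
  rw [tchi, mul_comm, Complex.norm_exp_ofReal_mul_I]

theorem tchi_cont {ι : Type} [Fintype ι] (w : ι → ℤ) : Continuous (tchi w) := by
  unfold tchi; fun_prop

/-- power expansion -/
theorem trig_pow {ι : Type} [Fintype ι] [DecidableEq ι] (g : ℝ → ℝ) (J : ℕ) (c : ℤ → ℂ)
    (hg : ∀ y, (g y : ℂ) = ∑ j ∈ Finset.Icc (-(J:ℤ)) J,
      c j * Complex.exp (Complex.I * ((2 * Real.pi * (j * y) : ℝ) : ℂ))) (m : ℕ) (y : ι → ℝ) :
    (((∑ k, g (y k)) ^ m : ℝ) : ℂ) =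
      ∑ r : Fin m → ι × Finset.Icc (-(J:ℤ)) J, (∏ i, c (r i).2) *
        tchi (fun k => ∑ i, if (r i).1 = k then ((r i).2 : ℤ) else 0) y := by
  have h1 : ((∑ k, g (y k) : ℝ) : ℂ) = ∑ q : ι × Finset.Icc (-(J:ℤ)) J,
      c q.2 * Complex.exp (Complex.I * ((2 * Real.pi * (((q.2 : ℤ) : ℝ) * y q.1) : ℝ) : ℂ)) := by
    rw [Fintype.sum_prod_type]
    push_cast
    apply Finset.sum_congr rfl
    intro k _
    rw [hg, ← Finset.sum_coe_sort]
    push_cast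
    rfl
  rw [Complex.ofReal_pow, h1, Fintype.sum_pow]
  apply Finset.sum_congr rfl
  intro r _
  rw [Finset.prod_mul_distrib, tchi, ← Complex.exp_sum]
  congr 2
  rw [← Finset.mul_sum, ← Complex.ofReal_sum, ← Finset.mul_sum]
  congr 3
  push_cast
  simp_rw [Finset.sum_mul]
  rw [Finset.sum_comm]
  apply Finset.sum_congr rfl
  intro i _
  simp [ite_mul]

theorem moment_expand {ι : Type} [Fintype ι] [DecidableEq ι] {Ω : Type} [MeasurableSpace Ω]
    (μ : Measure Ω) [IsProbabilityMeasure μ] (Y : Ω → ι → ℝ) (hY : Measurable Y)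
    (g : ℝ → ℝ) (J : ℕ) (c : ℤ → ℂ)
    (hg : ∀ y, (g y : ℂ) = ∑ j ∈ Finset.Icc (-(J:ℤ)) J,
      c j * Complex.exp (Complex.I * ((2 * Real.pi * (j * y) : ℝ) : ℂ))) (m : ℕ) :
    ((∫ ω, (∑ k, g (Y ω k)) ^ m ∂μ : ℝ) : ℂ) =
      ∑ r : Fin m → ι × Finset.Icc (-(J:ℤ)) J, (∏ i, c (r i).2) *
        ∫ ω, tchi (fun k => ∑ i, if (r i).1 = k then ((r i).2 : ℤ) else 0) (Y ω) ∂μ := by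
  rw [← integral_complex_ofReal]
  simp_rw [trig_pow g J c hg]
  rw [integral_finsetSum]
  · simp_rw [integral_const_mul]
  · intro r _
    apply Integrable.const_mul
    exact integrable_of_bdd μ _ ((tchi_cont _).measurable.comp hY).aestronglyMeasurable 1
      fun ω => (tchi_norm _ _).le

theorem model_chi {ι : Type} [Fintype ι] [DecidableEq ι] (ν : Measure ℝ) [IsProbabilityMeasure ν]
    (hν : ∀ j : ℤ, j ≠ 0 → ∫ u, Complex.exp (Complex.I * ((2 * Real.pi * (j * u) : ℝ) : ℂ)) ∂ν = 0)
    (w : ι → ℤ) (hw : w ≠ 0) : ∫ u, tchi w u ∂(Measure.pi fun _ : ι => ν) = 0 := by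
  have h1 : ∀ u : ι → ℝ, tchi w u =
      ∏ k, Complex.exp (Complex.I * ((2 * Real.pi * (w k * u k) : ℝ) : ℂ)) := by
    intro u
    rw [tchi, ← Complex.exp_sum, ← Finset.mul_sum, ← Complex.ofReal_sum, ← Finset.mul_sum]
  simp_rw [h1]
  rw [integral_fintype_prod_eq_prod (𝕜 := ℂ)
    (fun k (x : ℝ) => Complex.exp (Complex.I * ((2 * Real.pi * (w k * x) : ℝ) : ℂ)))]
  obtain ⟨k, hk⟩ := Function.ne_iff.1 hw
  exact Finset.prod_eq_zero (Finset.mem_univ k) (hν _ hk)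

theorem moment_cmp {ι : Type} [Fintype ι] [DecidableEq ι] {Ω : Type} [MeasurableSpace Ω]
    (μ : Measure Ω) [IsProbabilityMeasure μ] (Y : Ω → ι → ℝ) (hY : Measurable Y)
    (ν : Measure ℝ) [IsProbabilityMeasure ν]
    (hν : ∀ j : ℤ, j ≠ 0 → ∫ u, Complex.exp (Complex.I * ((2 * Real.pi * (j * u) : ℝ) : ℂ)) ∂ν = 0)
    (g : ℝ → ℝ) (J : ℕ) (c : ℤ → ℂ) (hc : ∀ j, ‖c j‖ ≤ 1)
    (hg : ∀ y, (g y : ℂ) = ∑ j ∈ Finset.Icc (-(J:ℤ)) J,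
      c j * Complex.exp (Complex.I * ((2 * Real.pi * (j * y) : ℝ) : ℂ))) (m : ℕ) (ρ : ℝ) (hρ0 : 0 ≤ ρ)
    (hρ : ∀ w : ι → ℤ, w ≠ 0 → (Finset.univ.filter (fun k => w k ≠ 0)).card ≤ m →
      ‖∫ ω, tchi w (Y ω) ∂μ‖ ≤ ρ) :
    |(∫ ω, (∑ k, g (Y ω k)) ^ m ∂μ) - ∫ u, (∑ k, g (u k)) ^ m ∂(Measure.pi fun _ : ι => ν)| ≤
      (Fintype.card ι * (2 * J + 1)) ^ m * ρ := by
  have e1 := moment_expand μ Y hY g J c hg m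
  have e2 := moment_expand (Measure.pi fun _ : ι => ν) id measurable_id g J c hg m
  rw [← Real.norm_eq_abs, ← Complex.norm_real, Complex.ofReal_sub, e1]
  simp only [id] at e2
  rw [e2, ← Finset.sum_sub_distrib]
  refine (norm_sum_le_of_le (f := _) (n := fun _ => ρ) _ ?_).trans (le_of_eq ?_)
  · intro r _
    rw [← mul_sub, norm_mul, norm_prod]
    set w : ι → ℤ := fun k => ∑ i, if (r i).1 = k then ((r i).2 : ℤ) else 0 with hw
    have h1 : ∏ i, ‖c (r i).2‖ ≤ 1 := Finset.prod_le_one (fun i _ => norm_nonneg _) fun i _ => hc _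
    have h2 : ‖(∫ ω, tchi w (Y ω) ∂μ) - ∫ u, tchi w u ∂(Measure.pi fun _ : ι => ν)‖ ≤ ρ := by
      by_cases hw0 : w = 0
      · rw [hw0]
        simp [tchi, hρ0]
      · rw [model_chi ν hν w hw0, sub_zero]
        apply hρ w hw0
        calc _ ≤ (Finset.univ.image fun i => (r i).1).card := by
              apply Finset.card_le_card
              intro k hk
              simp only [Finset.mem_filter, Finset.mem_univ, true_and] at hk
              obtain ⟨i, _, hi⟩ := Finset.exists_ne_zero_of_sum_ne_zero hk
              simp only [Finset.mem_image, Finset.mem_univ, true_and]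
              refine ⟨i, ?_⟩
              by_contra h
              simp [h] at hi
          _ ≤ m := Finset.card_image_le.trans (by simp)
    calc _ ≤ 1 * ρ := mul_le_mul h1 h2 (norm_nonneg _) zero_le_one
      _ = ρ := one_mul _
  · simp only [Finset.sum_const, nsmul_eq_mul, Finset.card_univ, Fintype.card_pi, Fintype.card_prod,
      Fintype.card_coe, Int.card_Icc, Finset.prod_const, Fintype.card_fin]
    have : ((J:ℤ) + 1 - -(J:ℤ)).toNat = 2 * J + 1 := by omega
    rw [this]
    push_cast
    ring


lemma per_int (f : ℝ → ℝ) (hper : ∀ x : ℝ, f (x + 1) = f x) (z : ℤ) (x : ℝ) : f (x + z) = f x := by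
  have h : Function.Periodic f 1 := hper
  have := (h.int_mul z) x
  simpa using this

lemma var_nat (f : ℝ → ℝ) (hper : ∀ x : ℝ, f (x + 1) = f x)
    (hvar : eVariationOn f (Set.Icc (0:ℝ) 1) ≤ 2) (n : ℕ) :
    eVariationOn f (Set.Icc (0:ℝ) n) ≤ 2 * n := by
  induction n with
  | zero => simp [eVariationOn.subsingleton]
  | succ k ih =>
    have h1 := eVariationOn.Icc_add_Icc (s := Set.univ) f (a := 0) (b := (k:ℝ)) (c := (k:ℝ) + 1)
      (by positivity) (by linarith) (Set.mem_univ _)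
    simp only [Set.univ_inter] at h1
    push_cast
    rw [← h1, mul_add]
    refine add_le_add ih ?_
    have h2 := eVariationOn.comp_eq_of_monotoneOn f (t := Set.Icc (0:ℝ) 1) (fun x => x + (k:ℝ))
      (fun a _ b _ hab => by simpa using hab)
    rw [Set.image_add_const_Icc] at h2
    have h3 : f ∘ (fun x => x + (k:ℝ)) = f := by
      ext x; simpa using per_int f hper k x
    rw [h3, zero_add, add_comm] at h2
    rw [← h2]; simpa using hvar

lemma f_meas (f : ℝ → ℝ) (hper : ∀ x : ℝ, f (x + 1) = f x)
    (hvar : eVariationOn f (Set.Icc (0:ℝ) 1) ≤ 2) : Measurable f := by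
  have hl : LocallyBoundedVariationOn f Set.univ := by
    intro a b _ _
    obtain ⟨n, hn⟩ := exists_nat_ge (max |a| |b|)
    have hsub : Set.univ ∩ Set.Icc a b ⊆ Set.Icc (-(n:ℝ)) n := by
      rintro x ⟨-, hx⟩
      have h1 := (le_max_left |a| |b|).trans hn
      have h2 := (le_max_right |a| |b|).trans hn
      have := neg_abs_le a
      have := le_abs_self b
      exact ⟨by linarith [hx.1], by linarith [hx.2]⟩
    refine ne_top_of_le_ne_top ?_ (eVariationOn.mono f hsub)
    have h2 := eVariationOn.comp_eq_of_monotoneOn f (t := Set.Icc (-(n:ℝ)) n) (fun x => x + (n:ℝ))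
      (fun a _ b _ hab => by simpa using hab)
    rw [Set.image_add_const_Icc] at h2
    have h3 : f ∘ (fun x => x + (n:ℝ)) = f := by
      ext x; simpa using per_int f hper n x
    rw [h3] at h2
    rw [h2]
    have h4 := var_nat f hper hvar (2 * n)
    have : -(n:ℝ) + n = 0 := by ring
    have h5 : (n:ℝ) + n = ((2 * n : ℕ) : ℝ) := by push_cast; ring
    rw [this, h5]
    exact ne_top_of_le_ne_top (by finiteness) h4
  obtain ⟨p, q, hp, hq, he⟩ := hl.exists_monotoneOn_sub_monotoneOn
  rw [monotoneOn_univ] at hp hq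
  rw [he]
  exact hp.measurable.sub hq.measurable

lemma f_osc (f : ℝ → ℝ)
    (hvar : eVariationOn f (Set.Icc (0:ℝ) 1) ≤ 2) {x y : ℝ} (hx : x ∈ Set.Icc (0:ℝ) 1)
    (hy : y ∈ Set.Icc (0:ℝ) 1) : |f x - f y| ≤ 2 := by
  have := (eVariationOn.edist_le f hx hy).trans hvar
  rw [edist_dist, Real.dist_eq] at this
  exact (ENNReal.ofReal_le_ofNat).1 this

lemma f_bdd (f : ℝ → ℝ) (hper : ∀ x : ℝ, f (x + 1) = f x)
    (hint : (∫ x in (0:ℝ)..1, f x) = 0)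
    (hvar : eVariationOn f (Set.Icc (0:ℝ) 1) ≤ 2) (x : ℝ) : |f x| ≤ 2 := by
  have hm := f_meas f hper hvar
  have h0 : f x = f (Int.fract x) := by
    have := per_int f hper ⌊x⌋ (Int.fract x)
    rwa [Int.fract_add_floor] at this
  rw [h0]
  set y := Int.fract x
  have hy : y ∈ Set.Icc (0:ℝ) 1 := ⟨Int.fract_nonneg x, (Int.fract_lt_one x).le⟩
  have hii : IntervalIntegrable f volume 0 1 := by
    have hb : ∀ z ∈ Set.Ioc (0:ℝ) 1, ‖f z‖ ≤ |f y| + 2 := by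
      intro z hz
      have := f_osc f hvar (Set.Ioc_subset_Icc_self hz) hy
      have h3 := abs_sub_abs_le_abs_sub (f z) (f y)
      rw [Real.norm_eq_abs]; linarith
    rw [intervalIntegrable_iff_integrableOn_Ioc_of_le zero_le_one]
    refine Measure.integrableOn_of_bounded (M := |f y| + 2) (by simp) hm.aestronglyMeasurable ?_
    exact (ae_restrict_iff' measurableSet_Ioc).2 (ae_of_all _ hb)
  have h1 : f y = ∫ z in (0:ℝ)..1, (f y - f z) := by
    rw [intervalIntegral.integral_sub (by simp) hii, hint]; simp
  rw [h1]
  have := intervalIntegral.norm_integral_le_of_norm_le_const (a := (0:ℝ)) (b := 1) (C := 2)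
    (f := fun z => f y - f z) (by
      intro z hz
      rw [Set.uIoc_of_le zero_le_one] at hz
      exact f_osc f hvar hy (Set.Ioc_subset_Icc_self hz))
  simpa using this

lemma ii_of_bdd {E : Type*} [NormedAddCommGroup E] [NormedSpace ℝ E] (f : ℝ → E) (hm : AEStronglyMeasurable f volume) (C : ℝ)
    (hC : ∀ x, ‖f x‖ ≤ C) (a b : ℝ) : IntervalIntegrable f volume a b := by
  rw [intervalIntegrable_iff]
  refine Measure.integrableOn_of_bounded (M := C) (by simp) hm ?_
  exact ae_of_all _ hC

lemma shift_L1 (f : ℝ → ℝ) (hper : ∀ x : ℝ, f (x + 1) = f x)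
    (hint : (∫ x in (0:ℝ)..1, f x) = 0)
    (hvar : eVariationOn f (Set.Icc (0:ℝ) 1) ≤ 2) (n : ℕ) (hn : 0 < n) (h : ℝ)
    (hh : n * h = 1) :
    ∫ x in (0:ℝ)..1, |f (x + h) - f x| ≤ 4 * h := by
  have hm := f_meas f hper hvar
  have hb := f_bdd f hper hint hvar
  have hn' : (0:ℝ) < n := by exact_mod_cast hn
  have hh0 : 0 < h := by
    by_contra hc
    push Not at hc
    nlinarith
  have hii : ∀ (c a b : ℝ), IntervalIntegrable (fun x => |f (x + c + h) - f (x + c)|) volume a b := by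
    intro c a b
    refine ii_of_bdd _ (Measurable.aestronglyMeasurable (by fun_prop)) 4 ?_ a b
    intro x
    rw [Real.norm_eq_abs, abs_abs]
    exact (abs_sub _ _).trans (by linarith [hb (x + c + h), hb (x + c)])
  have hii0 : ∀ (a b : ℝ), IntervalIntegrable (fun x => |f (x + h) - f (x)|) volume a b := by
    intro a b; simpa using hii 0 a b
  have e1 := intervalIntegral.sum_integral_adjacent_intervals (μ := volume)
    (f := fun x => |f (x + h) - f x|) (a := fun i : ℕ => (i:ℝ) * h) (n := n) (fun k _ => hii0 _ _)
  simp only [Nat.cast_zero, zero_mul, hh] at e1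
  rw [← e1]
  have e2 : ∀ k : ℕ, ∫ x in ((k:ℝ) * h)..(((k+1:ℕ):ℝ) * h), |f (x + h) - f x|
      = ∫ x in (0:ℝ)..h, |f (x + k * h + h) - f (x + k * h)| := by
    intro k
    rw [intervalIntegral.integral_comp_add_right (fun x => |f (x + h) - f x|) ((k:ℝ) * h)]
    congr 1
    · ring
    · push_cast; ring
  rw [Finset.sum_congr rfl (fun k _ => e2 k), ← intervalIntegral.integral_finsetSum (fun k _ => hii _ _ _)]
  have hle : ∀ x ∈ Set.Icc 0 h, ∑ k ∈ Finset.range n, |f (x + k * h + h) - f (x + k * h)| ≤ 4 := by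
    intro x hx
    have hs := eVariationOn.sum_le_of_monotoneOn_Iic (f := f) (s := Set.Icc (0:ℝ) ((2:ℕ):ℝ)) (n := n)
      (u := fun i : ℕ => x + i * h) (by
        intro i _ j _ hij
        have : (i:ℝ) ≤ j := by exact_mod_cast hij
        have := mul_le_mul_of_nonneg_right this hh0.le
        simp only; linarith) (by
        intro i hi
        have : (i:ℝ) ≤ n := by exact_mod_cast hi
        have h1 := mul_le_mul_of_nonneg_right this hh0.le
        have h2 : 1 * h ≤ n * h := mul_le_mul_of_nonneg_right (by exact_mod_cast hn) hh0.le
        have : 0 ≤ (i:ℝ) * h := by positivity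
        exact ⟨by linarith [hx.1], by push_cast; linarith [hx.2]⟩)
    have hs2 := hs.trans (var_nat f hper hvar 2)
    have e3 : ∑ i ∈ Finset.range n, edist (f (x + ((i+1:ℕ):ℝ) * h)) (f (x + (i:ℝ) * h))
        = ENNReal.ofReal (∑ k ∈ Finset.range n, |f (x + k * h + h) - f (x + k * h)|) := by
      rw [ENNReal.ofReal_sum_of_nonneg (fun _ _ => abs_nonneg _)]
      refine Finset.sum_congr rfl fun i _ => ?_
      rw [edist_dist, Real.dist_eq]
      congr 4
      push_cast; ring
    rw [e3] at hs2
    have : (2:ENNReal) * ((2:ℕ):ENNReal) = ENNReal.ofReal 4 := by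
      norm_num
    rw [this] at hs2
    exact (ENNReal.ofReal_le_ofReal_iff (by norm_num)).1 hs2
  calc _ ≤ ∫ x in (0:ℝ)..h, (4:ℝ) := by
        refine intervalIntegral.integral_mono_on hh0.le ?_ (by simp) hle
        refine ii_of_bdd _ (Measurable.aestronglyMeasurable (by fun_prop)) (∑ k ∈ Finset.range n, 4) ?_ 0 h
        intro x
        refine norm_sum_le_of_le _ fun k _ => ?_
        rw [Real.norm_eq_abs, abs_abs]
        exact (abs_sub _ _).trans (by linarith [hb (x + k * h + h), hb (x + k * h)])
    _ = 4 * h := by simp [mul_comm]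

noncomputable def ech (j : ℤ) (y : ℝ) : ℂ := Complex.exp (Complex.I * ((2 * Real.pi * (j * y) : ℝ) : ℂ))

lemma ech_norm (j : ℤ) (y : ℝ) : ‖ech j y‖ = 1 := by
  unfold ech; rw [mul_comm]; exact Complex.norm_exp_ofReal_mul_I _

lemma ech_cont (j : ℤ) : Continuous (ech j) := by
  unfold ech; fun_prop

lemma ech_per (j : ℤ) (y : ℝ) : ech j (y + 1) = ech j y := by
  unfold ech
  have : Complex.I * ((2 * Real.pi * (j * (y + 1)) : ℝ) : ℂ) = Complex.I * ((2 * Real.pi * (j * y) : ℝ) : ℂ)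
     + j * (2 * Real.pi * Complex.I) := by push_cast; ring
  rw [this, Complex.exp_add, Complex.exp_int_mul_two_pi_mul_I, mul_one]

lemma ech_conj (j : ℤ) (y : ℝ) : (starRingEnd ℂ) (ech j y) = ech (-j) y := by
  unfold ech
  rw [← Complex.exp_conj]
  congr 1
  simp
  left; exact map_ofNat _ 2

lemma ech_mul (i j : ℤ) (y : ℝ) : ech i y * ech j y = ech (i + j) y := by
  unfold ech
  rw [← Complex.exp_add]; congr 1; push_cast; ring

lemma ech_zero (y : ℝ) : ech 0 y = 1 := by simp [ech]

lemma ech_int (j : ℤ) (hj : j ≠ 0) : ∫ y in (0:ℝ)..1, ech j y = 0 := by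
  have hc : (Complex.I * (2 * Real.pi * j)) ≠ 0 := by
    simp [hj, Real.pi_ne_zero, Complex.I_ne_zero]
  have := integral_exp_mul_complex (a := 0) (b := 1) hc
  have e : ∀ y : ℝ, ech j y = Complex.exp (Complex.I * (2 * Real.pi * j) * y) := by
    intro y; unfold ech; congr 1; push_cast; ring
  simp only [e, this]
  have h1 : Complex.exp (Complex.I * (2 * Real.pi * j) * (1:ℝ)) = 1 := by
    rw [← Complex.exp_int_mul_two_pi_mul_I j]; congr 1; push_cast; ring
  rw [h1]; simp

noncomputable def fco (f : ℝ → ℝ) (j : ℤ) : ℂ := ∫ x in (0:ℝ)..1, (f x : ℂ) * ech (-j) x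

lemma fco_bound (f : ℝ → ℝ) (hper : ∀ x : ℝ, f (x + 1) = f x)
    (hint : (∫ x in (0:ℝ)..1, f x) = 0)
    (hvar : eVariationOn f (Set.Icc (0:ℝ) 1) ≤ 2) (j : ℤ) : ‖fco f j‖ * |(j:ℝ)| ≤ 1 := by
  rcases eq_or_ne j 0 with rfl | hj
  · simp
  have hm := f_meas f hper hvar
  have hb := f_bdd f hper hint hvar
  set n : ℕ := 2 * j.natAbs with hn
  have hn0 : 0 < n := by
    have := Int.natAbs_pos.2 hj; omega
  have hnj : (n:ℝ) = 2 * |(j:ℝ)| := by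
    rw [hn]; push_cast; rw [Nat.cast_natAbs]; simp
  have hn0' : (0:ℝ) < n := by exact_mod_cast hn0
  set h : ℝ := 1 / n with hh
  have hnh : n * h = 1 := by rw [hh]; field_simp
  have hs := shift_L1 f hper hint hvar n hn0 h hnh
  have hsh : ∀ x, ech (-j) (x + h) = - ech (-j) x := by
    intro x
    have hjh : (j:ℝ) * h = 1/2 ∨ (j:ℝ) * h = -(1/2) := by
      rw [hh, hnj]
      have hj' : (j:ℝ) ≠ 0 := by exact_mod_cast hj
      rcases abs_cases (j:ℝ) with ⟨h1, _⟩ | ⟨h1, _⟩ <;> rw [h1]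
      · left; field_simp
      · right; field_simp
    unfold ech
    have : Complex.I * ((2 * Real.pi * (((-j:ℤ):ℝ) * (x + h)) : ℝ) : ℂ) =
      Complex.I * ((2 * Real.pi * (((-j:ℤ):ℝ) * x) : ℝ) : ℂ) - 2 * Real.pi * Complex.I * ((j * h : ℝ):ℂ) := by
      push_cast; ring
    rw [this, Complex.exp_sub]
    rcases hjh with h1 | h1 <;> rw [h1]
    · have : 2 * (Real.pi:ℂ) * Complex.I * ((1/2:ℝ):ℂ) = Real.pi * Complex.I := by push_cast; ring
      rw [this, Complex.exp_pi_mul_I, div_neg, div_one]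
    · have : 2 * (Real.pi:ℂ) * Complex.I * ((-(1/2):ℝ):ℂ) = -(Real.pi * Complex.I) := by push_cast; ring
      rw [this, Complex.exp_neg, Complex.exp_pi_mul_I, inv_neg, inv_one, div_neg, div_one]
  have hmc : ∀ c, Measurable (fun x => (f (x + c) : ℂ) * ech (-j) x) := fun c =>
    (Complex.measurable_ofReal.comp (hm.comp (measurable_id.add_const c))).mul (ech_cont _).measurable
  have hI : ∀ c, IntervalIntegrable (fun x => (f (x + c) : ℂ) * ech (-j) x) volume 0 1 := by
    intro c
    refine ii_of_bdd _ (hmc c).aestronglyMeasurable 2 ?_ 0 1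
    intro x
    rw [norm_mul, ech_norm, mul_one, Complex.norm_real]; exact hb _
  have e1 : fco f j = - ∫ x in (0:ℝ)..1, (f (x + h) : ℂ) * ech (-j) x := by
    rw [← intervalIntegral.integral_neg]
    have : ∀ x, -((f (x + h) : ℂ) * ech (-j) x) = (fun x => (f x : ℂ) * ech (-j) x) (x + h) := by
      intro x; simp only [hsh]; ring
    simp only [this]
    rw [intervalIntegral.integral_comp_add_right (fun x => (f x : ℂ) * ech (-j) x)]
    have hp : Function.Periodic (fun x => (f x : ℂ) * ech (-j) x) 1 := by
      intro x; simp only [hper, ech_per]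
    have := hp.intervalIntegral_add_eq 0 (0 + h)
    unfold fco
    rw [zero_add, zero_add] at this
    rw [zero_add, this, add_comm]
  have e2 : 2 * fco f j = ∫ x in (0:ℝ)..1, ((f x : ℂ) - f (x + h)) * ech (-j) x := by
    simp only [sub_mul]
    have := hI 0
    simp only [add_zero] at this
    rw [intervalIntegral.integral_sub this (hI h)]
    have e3 : (∫ x in (0:ℝ)..1, (f x : ℂ) * ech (-j) x) = fco f j := rfl
    rw [e3, two_mul]
    nth_rewrite 2 [e1]
    ring
  have e4 : ‖2 * fco f j‖ ≤ ∫ x in (0:ℝ)..1, |f (x + h) - f x| := by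
    rw [e2]
    refine (intervalIntegral.norm_integral_le_integral_norm zero_le_one).trans (le_of_eq ?_)
    congr 1; ext x
    rw [norm_mul, ech_norm, mul_one, ← Complex.ofReal_sub, Complex.norm_real, Real.norm_eq_abs, abs_sub_comm]
  rw [norm_mul] at e4
  have e5 : 2 * ‖fco f j‖ ≤ 4 * h := by simpa using e4.trans hs
  have hja : (0:ℝ) < |(j:ℝ)| := by positivity
  have : h * |(j:ℝ)| = 1/2 := by rw [hh, hnj]; field_simp
  nlinarith [mul_le_mul_of_nonneg_right e5 hja.le]

lemma fco_zero (f : ℝ → ℝ) (hint : (∫ x in (0:ℝ)..1, f x) = 0) : fco f 0 = 0 := by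
  unfold fco
  simp only [neg_zero, ech_zero, mul_one]
  rw [intervalIntegral.integral_ofReal, hint]; simp

lemma fco_conj (f : ℝ → ℝ) (j : ℤ) : (starRingEnd ℂ) (fco f j) = fco f (-j) := by
  unfold fco
  rw [intervalIntegral.integral_of_le zero_le_one, intervalIntegral.integral_of_le zero_le_one, ← integral_conj]
  simp [ech_conj]

lemma fco_le_one (f : ℝ → ℝ) (hper : ∀ x : ℝ, f (x + 1) = f x)
    (hint : (∫ x in (0:ℝ)..1, f x) = 0)
    (hvar : eVariationOn f (Set.Icc (0:ℝ) 1) ≤ 2) (j : ℤ) : ‖fco f j‖ ≤ 1 := by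
  rcases eq_or_ne j 0 with rfl | hj
  · rw [fco_zero f hint]; simp
  have h1 := fco_bound f hper hint hvar j
  have : (1:ℝ) ≤ |(j:ℝ)| := by exact_mod_cast Int.one_le_abs hj
  nlinarith [norm_nonneg (fco f j)]


noncomputable def fg (f : ℝ → ℝ) (J : ℕ) (y : ℝ) : ℝ :=
  (∑ j ∈ Finset.Icc (-(J:ℤ)) J, fco f j * ech j y).re

lemma fg_eq (f : ℝ → ℝ) (J : ℕ) (y : ℝ) :
    (fg f J y : ℂ) = ∑ j ∈ Finset.Icc (-(J:ℤ)) J, fco f j * ech j y := by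
  unfold fg
  rw [← Complex.conj_eq_iff_re, map_sum]
  refine Finset.sum_nbij' (fun j => -j) (fun j => -j) ?_ ?_ ?_ ?_ ?_
  · intro j hj; simp only [Finset.mem_Icc] at *; omega
  · intro j hj; simp only [Finset.mem_Icc] at *; omega
  · intro j _; simp
  · intro j _; simp
  · intro j _; rw [map_mul, fco_conj, ech_conj]

lemma fg_cont (f : ℝ → ℝ) (J : ℕ) : Continuous (fg f J) := by
  unfold fg
  refine Complex.continuous_re.comp (continuous_finset_sum _ fun j _ => continuous_const.mul (ech_cont j))

lemma fg_per (f : ℝ → ℝ) (J : ℕ) (y : ℝ) : fg f J (y + 1) = fg f J y := by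
  unfold fg; simp only [ech_per]

lemma fg_coef (f : ℝ → ℝ) (J : ℕ) (i : ℤ) :
    fco (fg f J) i = if i ∈ Finset.Icc (-(J:ℤ)) J then fco f i else 0 := by
  have e : fco (fg f J) i = ∫ x in (0:ℝ)..1, ∑ j ∈ Finset.Icc (-(J:ℤ)) J, fco f j * ech (j - i) x := by
    rw [fco]
    congr 1; ext x
    rw [fg_eq, Finset.sum_mul]
    refine Finset.sum_congr rfl fun j _ => ?_
    rw [mul_assoc, ech_mul]; rfl
  have hii : ∀ j ∈ Finset.Icc (-(J:ℤ)) J,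
      IntervalIntegrable (fun x => fco f j * ech (j - i) x) volume 0 1 := fun j _ =>
    (continuous_const.mul (ech_cont _)).intervalIntegrable _ _
  rw [e, intervalIntegral.integral_finsetSum hii]
  simp only [intervalIntegral.integral_const_mul]
  have : ∀ j, ∫ x in (0:ℝ)..1, ech (j - i) x = if i = j then 1 else 0 := by
    intro j
    split_ifs with h
    · subst h; simp [ech_zero]
    · exact ech_int _ (by omega)
  simp only [this, mul_ite, mul_one, mul_zero]
  rw [Finset.sum_ite_eq]

lemma fg_int (f : ℝ → ℝ) (hint : (∫ x in (0:ℝ)..1, f x) = 0) (J : ℕ) :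
    ∫ x in (0:ℝ)..1, fg f J x = 0 := by
  have h := fg_coef f J 0
  rw [fco_zero f hint, ite_self, fco] at h
  simp only [neg_zero, ech_zero, mul_one] at h
  rw [intervalIntegral.integral_ofReal] at h
  exact_mod_cast h

lemma fg_sup (f : ℝ → ℝ) (hper : ∀ x : ℝ, f (x + 1) = f x)
    (hint : (∫ x in (0:ℝ)..1, f x) = 0)
    (hvar : eVariationOn f (Set.Icc (0:ℝ) 1) ≤ 2) :
    ∃ C : ℝ, 0 ≤ C ∧ ∀ N : ℕ, ∀ y, |fg f (N ^ 4) y| ≤ C * (N:ℝ) ^ (1/4:ℝ) := by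
  have hsum := Real.summable_abs_int_rpow (b := 17/16) (by norm_num)
  refine ⟨∑' n : ℤ, |(n:ℝ)| ^ (-(17/16):ℝ), tsum_nonneg fun n => by positivity, fun N y => ?_⟩
  have h1 : |fg f (N^4) y| ≤ ∑ j ∈ Finset.Icc (-((N^4:ℕ):ℤ)) ((N^4:ℕ):ℤ), ‖fco f j‖ := by
    refine (Complex.abs_re_le_norm _).trans ((norm_sum_le _ _).trans (le_of_eq ?_))
    refine Finset.sum_congr rfl fun j _ => ?_
    rw [norm_mul, ech_norm, mul_one]
  refine h1.trans ?_
  have h2 : ∀ j ∈ Finset.Icc (-((N^4:ℕ):ℤ)) ((N^4:ℕ):ℤ), ‖fco f j‖ ≤ |(j:ℝ)| ^ (-(17/16):ℝ) * (N:ℝ) ^ (1/4:ℝ) := by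
    intro j hj
    rcases eq_or_ne j 0 with rfl | hj0
    · rw [fco_zero f hint, norm_zero]; positivity
    have hb := fco_bound f hper hint hvar j
    have hj1 : (0:ℝ) < |(j:ℝ)| := by positivity
    have hjN : |(j:ℝ)| ≤ (N:ℝ) ^ (4:ℝ) := by
      rw [Finset.mem_Icc] at hj
      have : |j| ≤ ((N^4:ℕ):ℤ) := abs_le.2 hj
      have h3 : ((|j|:ℤ):ℝ) ≤ (((N^4:ℕ):ℤ):ℝ) := by exact_mod_cast this
      push_cast at h3
      have e4 : (N:ℝ) ^ (4:ℝ) = (N:ℝ)^4 := by exact_mod_cast Real.rpow_natCast (N:ℝ) 4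
      rw [e4]; exact h3
    have h4 : |(j:ℝ)| ^ (1/16:ℝ) ≤ (N:ℝ) ^ (1/4:ℝ) := by
      calc |(j:ℝ)| ^ (1/16:ℝ) ≤ ((N:ℝ) ^ (4:ℝ)) ^ (1/16:ℝ) := by gcongr
        _ = (N:ℝ) ^ (1/4:ℝ) := by rw [← Real.rpow_mul (by positivity)]; norm_num
    calc ‖fco f j‖ ≤ |(j:ℝ)| ^ (-1:ℝ) := by
          rw [Real.rpow_neg_one, ← one_div, le_div_iff₀ hj1]; exact hb
      _ = |(j:ℝ)| ^ (-(17/16):ℝ) * |(j:ℝ)| ^ (1/16:ℝ) := by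
          rw [← Real.rpow_add hj1]; norm_num
      _ ≤ _ := by gcongr
  refine (Finset.sum_le_sum h2).trans ?_
  rw [← Finset.sum_mul]
  gcongr
  exact hsum.sum_le_tsum _ (fun j _ => by positivity)

lemma parseval (r : ℝ → ℝ) (hm : Measurable r) (C : ℝ) (hC : ∀ x, |r x| ≤ C) :
    HasSum (fun i : ℤ => ‖fco r i‖ ^ 2) (∫ x in (0:ℝ)..1, (r x) ^ 2) := by
  have hL : MemLp (fun x => (r x : ℂ)) 2 (volume.restrict (Set.Ioc (0:ℝ) 1)) := by
    refine MemLp.of_bound (Complex.measurable_ofReal.comp hm).aestronglyMeasurable C (ae_of_all _ fun x => ?_)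
    rw [Complex.norm_real]; exact hC x
  have := hasSum_sq_fourierCoeffOn zero_lt_one hL
  convert this using 1
  · ext i
    congr 2
    rw [fourierCoeffOn_eq_integral, fco]
    simp only [sub_zero, div_one, one_smul, smul_eq_mul]
    congr 1; ext x
    rw [mul_comm]; congr 1
    unfold ech
    rw [fourier_coe_apply]
    congr 1; push_cast; ring
  · simp

lemma fg_L2 (f : ℝ → ℝ) (hper : ∀ x : ℝ, f (x + 1) = f x)
    (hint : (∫ x in (0:ℝ)..1, f x) = 0)
    (hvar : eVariationOn f (Set.Icc (0:ℝ) 1) ≤ 2) :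
    ∃ C : ℝ, 0 ≤ C ∧ ∀ N : ℕ, 1 ≤ N → ∫ x in (0:ℝ)..1, (f x - fg f (N ^ 4) x) ^ 2 ≤ C / (N:ℝ) ^ 2 := by
  have hm := f_meas f hper hvar
  have hb := f_bdd f hper hint hvar
  obtain ⟨C₁, hC₁, hsup⟩ := fg_sup f hper hint hvar
  have hsum := Real.summable_abs_int_rpow (b := 3/2) (by norm_num)
  refine ⟨∑' n : ℤ, |(n:ℝ)| ^ (-(3/2):ℝ), tsum_nonneg fun n => by positivity, fun N hN => ?_⟩
  have hN0 : (0:ℝ) < N := by exact_mod_cast hN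
  have hp := parseval (fun x => f x - fg f (N^4) x) (hm.sub (fg_cont f _).measurable)
    (2 + C₁ * (N:ℝ) ^ (1/4:ℝ)) (fun x => (abs_sub _ _).trans (add_le_add (hb x) (hsup N x)))
  have hc : ∀ i, fco (fun x => f x - fg f (N^4) x) i = fco f i - fco (fg f (N^4)) i := by
    intro i
    unfold fco
    rw [← intervalIntegral.integral_sub]
    · congr 1; ext x; push_cast; ring
    · refine ii_of_bdd _ (Measurable.aestronglyMeasurable ?_) 2 ?_ 0 1
      · exact (Complex.measurable_ofReal.comp hm).mul (ech_cont _).measurable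
      · intro x; rw [norm_mul, ech_norm, mul_one, Complex.norm_real]; exact hb x
    · exact ((Complex.continuous_ofReal.comp (fg_cont _ _)).mul (ech_cont _)).intervalIntegrable _ _
  have hle : ∀ i : ℤ, ‖fco (fun x => f x - fg f (N^4) x) i‖ ^ 2 ≤ |(i:ℝ)| ^ (-(3/2):ℝ) / (N:ℝ) ^ 2 := by
    intro i
    rw [hc, fg_coef]
    split_ifs with h
    · rw [sub_self, norm_zero, zero_pow two_ne_zero]; positivity
    rw [sub_zero]
    have hlt : ((N^4:ℕ):ℤ) < |i| := by
      by_contra hcon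
      push Not at hcon
      exact h (Finset.mem_Icc.2 (abs_le.1 hcon))
    have hlt' : (N:ℝ)^4 < |(i:ℝ)| := by
      have : (((N^4:ℕ):ℤ):ℝ) < ((|i|:ℤ):ℝ) := by exact_mod_cast hlt
      push_cast at this; exact this
    have hi : (0:ℝ) < |(i:ℝ)| := lt_trans (by positivity) hlt'
    have hbd := fco_bound f hper hint hvar i
    have h2 : (N:ℝ)^2 ≤ |(i:ℝ)| ^ (1/2:ℝ) := by
      rw [← Real.sqrt_eq_rpow]
      refine Real.le_sqrt_of_sq_le ?_
      rw [← pow_mul]; exact hlt'.le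
    rw [le_div_iff₀ (by positivity)]
    calc ‖fco f i‖^2 * (N:ℝ)^2 ≤ (|(i:ℝ)| ^ (-1:ℝ)) ^ 2 * |(i:ℝ)| ^ (1/2:ℝ) := by
          gcongr
          rw [Real.rpow_neg_one, ← one_div, le_div_iff₀ hi]; exact hbd
      _ = |(i:ℝ)| ^ (-(3/2):ℝ) := by
          rw [← Real.rpow_natCast, ← Real.rpow_mul hi.le, ← Real.rpow_add hi]; norm_num
  rw [← hp.tsum_eq]
  rw [← tsum_div_const]
  exact hp.summable.tsum_le_tsum hle (hsum.div_const _)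


lemma pow_conv (n : ℕ) (a b : ℝ) (ha : 0 ≤ a) (hab : a ≤ b) :
    b ^ (n + 1) - a ^ (n + 1) ≤ (n + 1) * b ^ n * (b - a) := by
  induction n with
  | zero => simp
  | succ n ih =>
    have hb : 0 ≤ b := ha.trans hab
    have h1 : a * (b ^ (n+1) - a ^ (n+1)) ≤ b * ((n + 1) * b ^ n * (b - a)) := by
      have h2 : 0 ≤ b ^ (n+1) - a ^ (n+1) := sub_nonneg.2 (by gcongr)
      exact mul_le_mul hab ih h2 hb
    have : b ^ (n+1+1) - a ^ (n+1+1) = b ^ (n+1) * (b - a) + a * (b ^ (n+1) - a ^ (n+1)) := by ring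
    rw [this]
    push_cast
    have e : (↑n + 1 + 1) * b ^ (n + 1) * (b - a) = b ^ (n+1) * (b - a) + b * ((n + 1) * b ^ n * (b - a)) := by ring
    rw [e]; linarith

lemma cell_bound (G : ℝ → ℝ) (hG : Measurable G) (h0 : ∀ x, 0 ≤ G x) (C : ℝ) (hC : ∀ x, G x ≤ C)
    (n : ℕ) (ξ a b : ℝ) (hξ : 0 < ξ) (ha : 0 < a) (hab : a ≤ b) :
    (ξ * ((n + 1) * a ^ n)) * ∫ x in a..b, G (ξ * x ^ (n + 1)) ≤ ∫ y in (ξ * a ^ (n+1))..(ξ * b ^ (n+1)), G y := by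
  have hφ : ξ * a ^ (n+1) ≤ ξ * b ^ (n+1) := by gcongr
  rw [intervalIntegral.integral_of_le hab, intervalIntegral.integral_of_le hφ]
  have hnC : ∀ x, ‖G x‖ ≤ C := fun x => by rw [Real.norm_eq_abs, abs_of_nonneg (h0 x)]; exact hC x
  have hinj : Set.InjOn (fun x : ℝ => ξ * x ^ (n+1)) (Set.Ioc a b) := by
    intro x hx y hy hxy
    have h1 : x ^ (n+1) = y ^ (n+1) := mul_left_cancel₀ hξ.ne' hxy
    exact (pow_left_inj₀ (ha.trans hx.1).le (ha.trans hy.1).le (by omega)).1 h1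
  have hcv := integral_image_eq_integral_abs_deriv_smul (s := Set.Ioc a b) measurableSet_Ioc
    (f := fun x : ℝ => ξ * x ^ (n+1)) (f' := fun x => ξ * ((n+1) * x ^ n)) (by
      intro x _
      have := ((hasDerivAt_pow (n+1) x).const_mul ξ).hasDerivWithinAt (s := Set.Ioc a b)
      simpa using this) hinj G
  have hsub : (fun x : ℝ => ξ * x ^ (n+1)) '' Set.Ioc a b ⊆ Set.Ioc (ξ * a ^ (n+1)) (ξ * b ^ (n+1)) := by
    rintro _ ⟨x, hx, rfl⟩
    have : 0 < x := ha.trans hx.1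
    refine ⟨?_, ?_⟩
    · have := pow_lt_pow_left₀ hx.1 ha.le (n := n+1) (by omega)
      simp only; gcongr
    · have := hx.2
      simp only; gcongr
  have hI : ∀ c d, IntegrableOn G (Set.Ioc c d) := fun c d =>
    Measure.integrableOn_of_bounded (M := C) (by simp) hG.aestronglyMeasurable (ae_of_all _ hnC)
  have h2 := setIntegral_mono_set (hI _ _) (ae_of_all _ h0) hsub.eventuallyLE
  refine le_trans ?_ h2
  rw [hcv, ← integral_const_mul]
  refine setIntegral_mono_on ?_ ?_ measurableSet_Ioc ?_
  · refine Measure.integrableOn_of_bounded (M := (ξ * ((n+1) * a ^ n)) * C) (by simp) (Measurable.aestronglyMeasurable (by fun_prop)) (ae_of_all _ fun x => ?_)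
    rw [norm_mul, Real.norm_of_nonneg (by positivity : 0 ≤ ξ * ((n+1) * a ^ n))]
    have := hnC (ξ * x ^ (n+1))
    gcongr
  · refine Measure.integrableOn_of_bounded (M := (ξ * ((n+1) * b ^ n)) * C) (by simp) (Measurable.aestronglyMeasurable (by fun_prop)) ?_
    refine (ae_restrict_iff' measurableSet_Ioc).2 (ae_of_all _ fun x hx => ?_)
    have hx0 : 0 < x := ha.trans hx.1
    have hx2 := hx.2
    have hb0 : 0 < b := ha.trans_le hab
    rw [norm_smul, Real.norm_eq_abs, abs_abs, abs_of_nonneg (by positivity)]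
    have := hnC (ξ * x ^ (n+1))
    gcongr
  · intro x hx
    have hx0 : 0 < x := ha.trans hx.1
    have hx2 := hx.1.le
    rw [abs_of_nonneg (by positivity), smul_eq_mul]
    have := h0 (ξ * x ^ (n+1))
    gcongr

lemma density (G : ℝ → ℝ) (hG : Measurable G) (h0 : ∀ x, 0 ≤ G x) (C : ℝ) (hC : ∀ x, G x ≤ C)
    (hper : ∀ x, G (x + 1) = G x)
    (k : ℕ) (hk : 1 ≤ k) (ξ A B : ℝ) (hξ : 0 < ξ) (hA : 1 < A) (hAB : A < B) :
    ∫ x in A..B, G (ξ * x ^ k) ≤ (1 / ξ + (B - A)) * ∫ y in (0:ℝ)..1, G y := by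
  obtain ⟨n, rfl⟩ : ∃ n, k = n + 1 := ⟨k - 1, by omega⟩
  have hA0 : 0 < A := by linarith
  have hnC : ∀ x, ‖G x‖ ≤ C := fun x => by rw [Real.norm_eq_abs, abs_of_nonneg (h0 x)]; exact hC x
  set I := ∫ y in (0:ℝ)..1, G y with hI
  have hI0 : 0 ≤ I := intervalIntegral.integral_nonneg zero_le_one (fun x _ => h0 x)
  have hunit : ∀ c, ∫ y in c..(c+1), G y = I := by
    intro c
    have hp : Function.Periodic G 1 := hper
    have := hp.intervalIntegral_add_eq c 0
    rw [this, zero_add]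
  set u : ℕ → ℝ := fun m => (A ^ (n+1) + m / ξ) ^ ((((n+1:ℕ):ℝ))⁻¹) with hu
  have hupos : ∀ m, 0 < u m := fun m => by simp only [hu]; positivity
  have hupow : ∀ m, u m ^ (n+1) = A ^ (n+1) + m / ξ := fun m =>
    Real.rpow_inv_natCast_pow (by positivity) (by omega)
  have hφu : ∀ m : ℕ, ξ * u (m+1) ^ (n+1) = ξ * u m ^ (n+1) + 1 := by
    intro m; rw [hupow, hupow]; push_cast; field_simp; ring
  have hu0 : u 0 = A := by
    refine (pow_left_inj₀ (hupos 0).le hA0.le (n := n+1) (by omega)).1 ?_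
    rw [hupow]; simp
  have humono : ∀ m, u m ≤ u (m+1) := by
    intro m
    refine (pow_le_pow_iff_left₀ (hupos m).le (hupos _).le (n := n+1) (by omega)).1 ?_
    have := hφu m
    nlinarith
  have hAu : ∀ m, A ≤ u m := by
    intro m; rw [← hu0]; exact monotone_nat_of_le_succ humono (Nat.zero_le m)
  have hii : ∀ a b, IntervalIntegrable (fun x => G (ξ * x ^ (n+1))) volume a b := fun a b =>
    ii_of_bdd _ (Measurable.aestronglyMeasurable (by fun_prop)) C (fun x => hnC _) a b
  have hcell : ∀ m, (ξ * ((n + 1) * u m ^ n)) * ∫ x in (u m)..(u (m+1)), G (ξ * x ^ (n + 1)) ≤ I := by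
    intro m
    have := cell_bound G hG h0 C hC n ξ (u m) (u (m+1)) hξ (hupos m) (humono m)
    rwa [hφu, hunit] at this
  have hmain : ∀ m, ∫ x in A..(u (m+1)), G (ξ * x ^ (n+1)) ≤ (1 / ξ + (u m - A)) * I := by
    intro m
    induction m with
    | zero =>
      have h1 := hcell 0
      rw [hu0] at h1 ⊢
      rw [sub_self, add_zero, one_div, inv_mul_eq_div, le_div_iff₀ hξ]
      refine le_trans ?_ h1
      have hnn : 0 ≤ ∫ x in A..(u (0+1)), G (ξ * x ^ (n + 1)) :=
        intervalIntegral.integral_nonneg (hAu _) (fun x _ => h0 _)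
      rw [mul_comm]
      refine mul_le_mul_of_nonneg_right ?_ hnn
      have : (1:ℝ) ≤ (n+1) * A ^ n := by
        have h3 : (1:ℝ) ≤ A ^ n := one_le_pow₀ hA.le
        have h4 : (0:ℝ) ≤ n := Nat.cast_nonneg n
        nlinarith
      nlinarith
    | succ m ih =>
      rw [← intervalIntegral.integral_add_adjacent_intervals (hii A (u (m+1))) (hii _ _)]
      have h1 := hcell (m+1)
      have hD : 0 < (ξ * ((n + 1) * u (m+1) ^ n)) := by have := hupos (m+1); positivity
      have h2 : 1 ≤ (ξ * ((n + 1) * u (m+1) ^ n)) * (u (m+1) - u m) := by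
        have h3 := pow_conv n (u m) (u (m+1)) (hupos m).le (humono m)
        have h4 := mul_le_mul_of_nonneg_left h3 hξ.le
        have := hφu m
        nlinarith
      have h5 : ∫ x in (u (m+1))..(u (m+1+1)), G (ξ * x ^ (n + 1)) ≤ (u (m+1) - u m) * I := by
        have h6 : (ξ * ((n + 1) * u (m+1) ^ n)) * ∫ x in (u (m+1))..(u (m+1+1)), G (ξ * x ^ (n + 1))
          ≤ (ξ * ((n + 1) * u (m+1) ^ n)) * ((u (m+1) - u m) * I) := by
          refine h1.trans ?_
          rw [← mul_assoc]
          nlinarith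
        exact le_of_mul_le_mul_left h6 hD
      nlinarith
  set M := ⌊ξ * B ^ (n+1) - ξ * A ^ (n+1)⌋₊ with hM
  have hAB' : ξ * A ^ (n+1) ≤ ξ * B ^ (n+1) := by gcongr
  have hM1 : (M:ℝ) ≤ ξ * B ^ (n+1) - ξ * A ^ (n+1) := Nat.floor_le (by linarith)
  have hM2 : ξ * B ^ (n+1) - ξ * A ^ (n+1) < M + 1 := Nat.lt_floor_add_one _
  have hφM : ∀ m : ℕ, ξ * u m ^ (n+1) = ξ * A ^ (n+1) + m := by
    intro m; rw [hupow]; field_simp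
  have hB0 : 0 ≤ B := by linarith
  have huM : u M ≤ B := by
    refine (pow_le_pow_iff_left₀ (hupos M).le hB0 (n := n+1) (by omega)).1 ?_
    have := hφM M
    exact le_of_mul_le_mul_left (by linarith) hξ
  have huM1 : B ≤ u (M+1) := by
    refine (pow_le_pow_iff_left₀ hB0 (hupos _).le (n := n+1) (by omega)).1 ?_
    have := hφM (M+1)
    push_cast at this
    exact le_of_mul_le_mul_left (by linarith) hξ
  calc ∫ x in A..B, G (ξ * x ^ (n+1)) ≤ ∫ x in A..(u (M+1)), G (ξ * x ^ (n+1)) := by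
        rw [← intervalIntegral.integral_add_adjacent_intervals (hii A B) (hii B (u (M+1)))]
        have h9 : 0 ≤ ∫ x in B..(u (M+1)), G (ξ * x ^ (n+1)) :=
          intervalIntegral.integral_nonneg huM1 (fun x _ => h0 _)
        exact le_add_of_nonneg_right h9
    _ ≤ (1 / ξ + (u M - A)) * I := hmain M
    _ ≤ _ := by gcongr


lemma cexp_lip (a b : ℝ) : ‖Complex.exp (Complex.I * a) - Complex.exp (Complex.I * b)‖ ≤ |a - b| := by
  have e : Complex.exp (Complex.I * a) - Complex.exp (Complex.I * b)
      = Complex.exp (Complex.I * b) * (Complex.exp (Complex.I * ((a - b : ℝ) : ℂ)) - 1) := by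
    rw [mul_sub, mul_one, ← Complex.exp_add]; congr 2; push_cast; ring
  rw [e, norm_mul, mul_comm Complex.I (b:ℂ), Complex.norm_exp_ofReal_mul_I, one_mul]
  exact Real.norm_exp_I_mul_ofReal_sub_one_le

lemma cexp_norm (a : ℝ) : ‖Complex.exp (Complex.I * a)‖ = 1 := by
  rw [mul_comm, Complex.norm_exp_ofReal_mul_I]

lemma pow_lip (a b : ℂ) (ha : ‖a‖ ≤ 1) (hb : ‖b‖ ≤ 1) (n : ℕ) : ‖a ^ n - b ^ n‖ ≤ n * ‖a - b‖ := by
  induction n with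
  | zero => simp
  | succ n ih =>
    have e : a ^ (n+1) - b ^ (n+1) = a ^ n * (a - b) + (a ^ n - b ^ n) * b := by ring
    rw [e]
    refine (norm_add_le _ _).trans ?_
    rw [norm_mul, norm_mul, norm_pow]
    have h1 : ‖a‖ ^ n ≤ 1 := pow_le_one₀ (norm_nonneg _) ha
    have h2 := norm_nonneg (a - b)
    have h3 := norm_nonneg (a ^ n - b ^ n)
    push_cast
    nlinarith

/-- char function integrals are Lipschitz -/
lemma charint_lip {Ω : Type} [MeasurableSpace Ω] (μ : Measure Ω) [IsProbabilityMeasure μ]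
    (X Y : Ω → ℝ) (hX : Measurable X) (hY : Measurable Y) (C : ℝ) (hC : ∀ ω, |X ω - Y ω| ≤ C) :
    ‖(∫ ω, Complex.exp (Complex.I * X ω) ∂μ) - ∫ ω, Complex.exp (Complex.I * Y ω) ∂μ‖
      ≤ ∫ ω, |X ω - Y ω| ∂μ := by
  have hm : ∀ W : Ω → ℝ, Measurable W → Integrable (fun ω => Complex.exp (Complex.I * W ω)) μ := by
    intro W hW
    refine integrable_of_bdd μ _ (Measurable.aestronglyMeasurable ?_) 1 (fun x => (cexp_norm _).le)
    fun_prop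
  rw [← integral_sub (hm X hX) (hm Y hY)]
  refine (norm_integral_le_integral_norm _).trans ?_
  refine integral_mono_of_nonneg (ae_of_all _ fun _ => norm_nonneg _) ?_ (ae_of_all _ fun ω => cexp_lip _ _)
  refine integrable_of_bdd μ _ (Measurable.aestronglyMeasurable ?_) C (fun x => ?_)
  · fun_prop
  · simpa using hC x

lemma charint_norm {Ω : Type} [MeasurableSpace Ω] (μ : Measure Ω) [IsProbabilityMeasure μ]
    (X : Ω → ℝ) : ‖∫ ω, Complex.exp (Complex.I * X ω) ∂μ‖ ≤ 1 := by
  refine (norm_integral_le_integral_norm _).trans ?_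
  simp [cexp_norm]

noncomputable def unitM : Measure ℝ := volume.restrict (Set.Ioc (0:ℝ) 1)

instance unitM_prob : IsProbabilityMeasure unitM := ⟨by simp [unitM]⟩

lemma unitM_int {E : Type*} [NormedAddCommGroup E] [NormedSpace ℝ E] (f : ℝ → E) :
    ∫ x, f x ∂unitM = ∫ x in (0:ℝ)..1, f x := by
  rw [intervalIntegral.integral_of_le zero_le_one]; rfl

lemma fg_L1 (f : ℝ → ℝ) (hper : ∀ x : ℝ, f (x + 1) = f x)
    (hint : (∫ x in (0:ℝ)..1, f x) = 0)
    (hvar : eVariationOn f (Set.Icc (0:ℝ) 1) ≤ 2) :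
    ∃ C : ℝ, 0 ≤ C ∧ ∀ N : ℕ, 1 ≤ N → ∫ x in (0:ℝ)..1, |f x - fg f (N ^ 4) x| ≤ C / N := by
  obtain ⟨C, hC, h⟩ := fg_L2 f hper hint hvar
  obtain ⟨C₁, hC₁, hsup⟩ := fg_sup f hper hint hvar
  have hm := f_meas f hper hvar
  have hb := f_bdd f hper hint hvar
  refine ⟨C + 1, by positivity, fun N hN => ?_⟩
  have hN0 : (0:ℝ) < N := by exact_mod_cast hN
  have hgm := (fg_cont f (N^4)).measurable
  have hr : ∀ x, |f x - fg f (N^4) x| ≤ 2 + C₁ * (N:ℝ) ^ (1/4:ℝ) := fun x =>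
    (abs_sub _ _).trans (add_le_add (hb x) (hsup N x))
  have hR0 : 0 ≤ 2 + C₁ * (N:ℝ) ^ (1/4:ℝ) := by positivity
  have hi1 : Integrable (fun x => (f x - fg f (N^4) x)^2) unitM := by
    refine integrable_of_bdd unitM _ (Measurable.aestronglyMeasurable (by fun_prop)) ((2 + C₁ * (N:ℝ) ^ (1/4:ℝ))^2) fun x => ?_
    rw [norm_pow, Real.norm_eq_abs]
    have := hr x
    gcongr
  rw [← unitM_int]
  calc ∫ x, |f x - fg f (N ^ 4) x| ∂unitM ≤ ∫ x, (N * (f x - fg f (N^4) x)^2 + 1 / N) ∂unitM := by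
        refine integral_mono_of_nonneg (ae_of_all _ fun _ => abs_nonneg _) ?_ (ae_of_all _ fun x => ?_)
        · exact (hi1.const_mul _).add (integrable_const _)
        · simp only
          set r := f x - fg f (N^4) x
          rw [← sq_abs r]
          have h1 : 0 ≤ (N * |r| - 1) ^ 2 / N := by positivity
          have h2 : (N * |r| - 1) ^ 2 / N = N * |r| ^ 2 - 2 * |r| + 1 / N := by field_simp; ring
          have := abs_nonneg r
          linarith
    _ = N * (∫ x in (0:ℝ)..1, (f x - fg f (N^4) x)^2) + 1 / N := by
        rw [integral_add (hi1.const_mul _) (integrable_const _), integral_const_mul, unitM_int]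
        simp
    _ ≤ N * (C / (N:ℝ)^2) + 1 / N := by gcongr; exact h N hN
    _ = (C + 1) / N := by field_simp

lemma model_lim (f : ℝ → ℝ) (hper : ∀ x : ℝ, f (x + 1) = f x)
    (hint : (∫ x in (0:ℝ)..1, f x) = 0)
    (hvar : eVariationOn f (Set.Icc (0:ℝ) 1) ≤ 2)
    (σ : ℝ) (hσdef : σ = Real.sqrt (∫ x in (0:ℝ)..1, (f x) ^ 2)) (hσ : 0 < σ) (θ : ℝ)
    (t K : ℕ → ℕ) (ht : ∀ N, t N ≤ N) (htK : ∀ N, N ≤ t N + K N)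
    (hK : Tendsto (fun N => (K N : ℝ) / Real.sqrt N) atTop (nhds 0)) :
    Tendsto (fun N : ℕ => (∫ u, Complex.exp (Complex.I * ((θ / (σ * Real.sqrt N) * fg f (N^4) u : ℝ) : ℂ)) ∂unitM) ^ t N)
      atTop (nhds (Complex.exp (-(θ:ℂ) ^ 2 / 2))) := by
  obtain ⟨D, hD, hL1⟩ := fg_L1 f hper hint hvar
  obtain ⟨C₁, hC₁, hsup⟩ := fg_sup f hper hint hvar
  have hm := f_meas f hper hvar
  have hb := f_bdd f hper hint hvar
  have hsq : σ ^ 2 = ∫ x in (0:ℝ)..1, (f x) ^ 2 := by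
    rw [hσdef, Real.sq_sqrt]
    exact intervalIntegral.integral_nonneg zero_le_one (fun x _ => sq_nonneg _)
  set pf : ℕ → ℂ := fun N => ∫ u, Complex.exp (Complex.I * ((θ / (σ * Real.sqrt N) * f u : ℝ) : ℂ)) ∂unitM with hpf
  set pg : ℕ → ℂ := fun N => ∫ u, Complex.exp (Complex.I * ((θ / (σ * Real.sqrt N) * fg f (N^4) u : ℝ) : ℂ)) ∂unitM with hpg
  have hpfn : ∀ N, ‖pf N‖ ≤ 1 := fun N => charint_norm unitM _
  have hpgn : ∀ N, ‖pg N‖ ≤ 1 := fun N => charint_norm unitM _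
  have hclt : Tendsto (fun N => pf N ^ N) atTop (nhds (Complex.exp (-(θ:ℂ) ^ 2 / 2))) := by
    have := ProbabilityTheory.tendsto_charFun_inv_sqrt_mul_pow (P := unitM) (X := fun x => f x / σ)
      (hm.div_const σ).aemeasurable
      (by rw [unitM_int, intervalIntegral.integral_div, hint, zero_div])
      (by
        rw [unitM_int]
        simp only [Pi.pow_apply, div_pow]
        rw [intervalIntegral.integral_div, ← hsq, div_self (by positivity)]) θ
    refine this.congr fun N => ?_
    congr 1
    rw [charFun_apply_real, integral_map (hm.div_const σ).aemeasurable (by fun_prop)]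
    simp only [hpf]
    congr 1; ext u
    congr 1; push_cast
    simp only [div_eq_mul_inv, mul_inv]
    ring
  have hpgf : ∀ N, 1 ≤ N → ‖pg N - pf N‖ ≤ |θ| / (σ * Real.sqrt N) * (D / N) := by
    intro N hN
    have h1 := charint_lip unitM (fun u => θ / (σ * Real.sqrt N) * fg f (N^4) u)
      (fun u => θ / (σ * Real.sqrt N) * f u) (measurable_const.mul (fg_cont f _).measurable)
      (measurable_const.mul hm) (|θ / (σ * Real.sqrt N)| * (C₁ * (N:ℝ) ^ (1/4:ℝ) + 2)) (fun u => by
        rw [← mul_sub, abs_mul]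
        exact mul_le_mul_of_nonneg_left ((abs_sub _ _).trans (add_le_add (hsup N u) (hb u))) (abs_nonneg _))
    refine h1.trans ?_
    simp only [← mul_sub, abs_mul]
    rw [integral_const_mul, unitM_int, abs_div, abs_of_nonneg (by positivity : 0 ≤ σ * Real.sqrt N)]
    refine mul_le_mul_of_nonneg_left ?_ (by positivity)
    simp only [abs_sub_comm (fg f _ _)]
    exact hL1 N hN
  have hpf1 : ∀ N, ‖pf N - 1‖ ≤ |θ| / (σ * Real.sqrt N) * 2 := by
    intro N
    have h1 := charint_lip unitM (fun u => θ / (σ * Real.sqrt N) * f u) (fun u => 0)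
      (measurable_const.mul hm) measurable_const (|θ / (σ * Real.sqrt N)| * 2) (fun u => by
        rw [sub_zero, abs_mul]
        exact mul_le_mul_of_nonneg_left (hb u) (abs_nonneg _))
    have e : ∫ ω, Complex.exp (Complex.I * ((0:ℝ):ℂ)) ∂unitM = 1 := by simp
    rw [e] at h1
    refine h1.trans ?_
    simp only [sub_zero, abs_mul]
    rw [integral_const_mul, abs_div, abs_of_nonneg (by positivity : 0 ≤ σ * Real.sqrt N)]
    refine mul_le_mul_of_nonneg_left ?_ (by positivity)
    have := integral_mono_of_nonneg (μ := unitM) (ae_of_all _ fun x => abs_nonneg (f x)) (integrable_const 2)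
      (ae_of_all _ hb)
    simpa using this
  have hdiff : ∀ N, 1 ≤ N → ‖pg N ^ t N - pf N ^ N‖ ≤ |θ| / σ * (D / Real.sqrt N + 2 * (K N / Real.sqrt N)) := by
    intro N hN
    have hN0 : (0:ℝ) < N := by exact_mod_cast hN
    have hs0 : 0 < Real.sqrt N := Real.sqrt_pos.2 hN0
    obtain ⟨r, hr⟩ := Nat.exists_eq_add_of_le (ht N)
    have hrK : (r:ℝ) ≤ K N := by
      have := htK N; exact_mod_cast (by omega : r ≤ K N)
    have htN : (t N : ℝ) ≤ N := by exact_mod_cast ht N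
    have e : pg N ^ t N - pf N ^ N = (pg N ^ t N - pf N ^ t N) + pf N ^ t N * (1 ^ r - pf N ^ r) := by
      have e0 : pf N ^ N = pf N ^ t N * pf N ^ r := by
        rw [← pow_add, ← hr]
      rw [e0]; ring
    rw [e]
    refine (norm_add_le _ _).trans ?_
    rw [norm_mul, norm_pow]
    have h1 := pow_lip (pg N) (pf N) (hpgn N) (hpfn N) (t N)
    have h2 := pow_lip 1 (pf N) (by simp) (hpfn N) r
    rw [norm_sub_rev 1] at h2
    have h3 : ‖pf N‖ ^ t N ≤ 1 := pow_le_one₀ (norm_nonneg _) (hpfn N)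
    have h4 : (t N : ℝ) * ‖pg N - pf N‖ ≤ N * (|θ| / (σ * Real.sqrt N) * (D / N)) := by
      have := hpgf N hN; gcongr
    have h5 : (r : ℝ) * ‖pf N - 1‖ ≤ K N * (|θ| / (σ * Real.sqrt N) * 2) := by
      have := hpf1 N; gcongr
    have h6 : ‖pf N‖ ^ t N * ‖1 ^ r - pf N ^ r‖ ≤ 1 * ‖1 ^ r - pf N ^ r‖ := by gcongr
    have e2 : |θ| / σ * (D / Real.sqrt N + 2 * (K N / Real.sqrt N)) = N * (|θ| / (σ * Real.sqrt N) * (D / N))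
      + K N * (|θ| / (σ * Real.sqrt N) * 2) := by field_simp
    rw [e2]; linarith
  have hz : Tendsto (fun N : ℕ => |θ| / σ * (D / Real.sqrt N + 2 * (K N / Real.sqrt N))) atTop (nhds 0) := by
    have h1 : Tendsto (fun N : ℕ => D / Real.sqrt N) atTop (nhds 0) :=
      (Real.tendsto_sqrt_atTop.comp tendsto_natCast_atTop_atTop).const_div_atTop D
    have := (h1.add (hK.const_mul 2)).const_mul (|θ| / σ)
    simpa using this
  have hd0 : Tendsto (fun N => pg N ^ t N - pf N ^ N) atTop (nhds 0) := by
    refine squeeze_zero_norm' ?_ hz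
    filter_upwards [eventually_ge_atTop 1] with N hN using hdiff N hN
  have := hd0.add hclt
  rw [zero_add] at this
  refine this.congr fun N => ?_
  rw [sub_add_cancel]


noncomputable def intM (A B : ℝ) : Measure ℝ := (ENNReal.ofReal (B - A))⁻¹ • volume.restrict (Set.Icc A B)

lemma intM_prob (A B : ℝ) (hAB : A < B) : IsProbabilityMeasure (intM A B) := ⟨by
  simp only [intM, Measure.smul_apply, smul_eq_mul, Measure.restrict_apply MeasurableSet.univ, Set.univ_inter,
    Real.volume_Icc]
  exact ENNReal.inv_mul_cancel (by simpa using hAB) (by simp)⟩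

lemma intM_int {E : Type*} [NormedAddCommGroup E] [NormedSpace ℝ E] (A B : ℝ) (hAB : A < B) (f : ℝ → E) :
    ∫ x, f x ∂(intM A B) = (B - A)⁻¹ • ∫ x in A..B, f x := by
  rw [intM, integral_smul_measure, intervalIntegral.integral_of_le hAB.le, integral_Icc_eq_integral_Ioc]
  congr 1
  rw [ENNReal.toReal_inv, ENNReal.toReal_ofReal (by linarith)]

lemma exp_bound (g : ℝ → ℝ) (hgm : Measurable g) (S V h : ℝ) (hS : ∀ x, |g x| ≤ S) (hhS : 2 * |h| * S ≤ 1)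
    (hg0 : ∫ x, g x ∂unitM = 0) (hV : ∫ x, g x ^ 2 ∂unitM ≤ V) (ι : Type) [Fintype ι] (N : ℕ)
    (hN : Fintype.card ι ≤ N) :
    ∫ u : ι → ℝ, Real.exp (2 * (h * ∑ k, g (u k))) ∂(Measure.pi fun _ : ι => unitM)
      ≤ Real.exp (4 * h ^ 2 * V * N) := by
  have e : ∀ u : ι → ℝ, Real.exp (2 * (h * ∑ k, g (u k))) = ∏ k, Real.exp (2 * h * g (u k)) := by
    intro u
    rw [← Real.exp_sum, ← Finset.mul_sum]; congr 1; ring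
  simp only [e]
  rw [integral_fintype_prod_eq_pow (fun x => Real.exp (2 * h * g x))]
  have hV0 : 0 ≤ V := le_trans (integral_nonneg fun x => sq_nonneg _) hV
  have hsmall : ∀ x, |2 * h * g x| ≤ 1 := by
    intro x
    rw [abs_mul, abs_mul, abs_two]
    refine le_trans ?_ hhS
    have := hS x
    gcongr
  have hS0 : 0 ≤ S := (abs_nonneg _).trans (hS 0)
  have hi1 : Integrable g unitM := integrable_of_bdd unitM _ hgm.aestronglyMeasurable S hS
  have hi2 : Integrable (fun x => g x ^ 2) unitM := by
    refine integrable_of_bdd unitM _ (hgm.pow_const 2).aestronglyMeasurable (S ^ 2) fun x => ?_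
    rw [norm_pow, Real.norm_eq_abs]
    have := hS x
    gcongr
  have h1 : ∫ x, Real.exp (2 * h * g x) ∂unitM ≤ Real.exp (4 * h ^ 2 * V) := by
    calc ∫ x, Real.exp (2 * h * g x) ∂unitM ≤ ∫ x, (1 + 2 * h * g x + 4 * h ^ 2 * g x ^ 2) ∂unitM := by
          refine integral_mono_of_nonneg (ae_of_all _ fun _ => (Real.exp_pos _).le) ?_ (ae_of_all _ fun x => ?_)
          · exact ((integrable_const _).add (hi1.const_mul _)).add (hi2.const_mul _)
          · have := (abs_le.1 (Real.abs_exp_sub_one_sub_id_le (hsmall x))).2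
            simp only
            nlinarith
      _ = 1 + 4 * h ^ 2 * ∫ x, g x ^ 2 ∂unitM := by
          have hi3 : Integrable (fun x => 1 + 2 * h * g x) unitM :=
            (integrable_const _).add (hi1.const_mul _)
          rw [integral_add hi3 (hi2.const_mul _),
            integral_add (integrable_const _) (hi1.const_mul _), integral_const_mul, integral_const_mul, hg0]
          simp
      _ ≤ 1 + 4 * h ^ 2 * V := by gcongr
      _ ≤ _ := by linarith [Real.add_one_le_exp (4 * h ^ 2 * V)]
  have h2 : 0 ≤ ∫ x, Real.exp (2 * h * g x) ∂unitM := integral_nonneg fun x => (Real.exp_pos _).le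
  calc _ ≤ (Real.exp (4 * h ^ 2 * V)) ^ Fintype.card ι := by gcongr
    _ ≤ (Real.exp (4 * h ^ 2 * V)) ^ N := by
        refine pow_le_pow_right₀ (Real.one_le_exp (by positivity)) hN
    _ = _ := by rw [← Real.exp_nat_mul]; congr 1; ring

lemma step2 (f : ℝ → ℝ) (hper : ∀ x : ℝ, f (x + 1) = f x)
    (hint : (∫ x in (0:ℝ)..1, f x) = 0)
    (hvar : eVariationOn f (Set.Icc (0:ℝ) 1) ≤ 2) (ξ A B : ℝ) (hAB : A < B)
    (J N K M : ℕ) (hM : Even M) (hN : 1 ≤ N) (hK : 2 ≤ K) (C q : ℝ) (hC : 0 ≤ C) (hq : 0 < q)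
    (hosc : ∀ K : ℕ, 2 ≤ K → ∀ (ι : Type) [DecidableEq ι] (s : Finset ι) (e : ι → ℕ) (c : ι → ℝ),
      s.Nonempty → s.card ≤ M → Set.InjOn e s → (∀ i ∈ s, K ≤ e i) → (∀ i ∈ s, 1 ≤ |c i|) →
      ‖∫ x in A..B, Complex.exp (Complex.I * ((2 * Real.pi * ξ * ∑ i ∈ s, c i * x ^ e i : ℝ) : ℂ))‖ ≤ C * q ^ K)
    (T : Finset ℕ) (hT : T.card ≤ N) (hTK : ∀ k ∈ T, K ≤ k) (h S V : ℝ) (hh1 : |h| ≤ 1)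
    (hS : ∀ x, |fg f J x| ≤ S) (hhS : 2 * |h| * S ≤ 1) (hV : ∫ x, fg f J x ^ 2 ∂unitM ≤ V) :
    ‖(∫ x, Complex.exp (Complex.I * ((h * ∑ k ∈ T, fg f J (ξ * x ^ k) : ℝ) : ℂ)) ∂(intM A B))
      - (∫ u, Complex.exp (Complex.I * ((h * fg f J u : ℝ) : ℂ)) ∂unitM) ^ T.card‖
      ≤ (M + 1) * ((N * (2 * J + 1)) ^ M * ((B - A)⁻¹ * (C * q ^ K)))
        + 2 * (2⁻¹ ^ M * (2 * Real.exp (4 * h ^ 2 * V * N))) := by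
  have := intM_prob A B hAB
  set g := fg f J with hg
  have hgc : Continuous g := fg_cont f J
  have hgm : Measurable g := hgc.measurable
  have hS0 : 0 ≤ S := (abs_nonneg _).trans (hS 0)
  have hBA : 0 < (B - A)⁻¹ := inv_pos.2 (by linarith)
  set ρ := (B - A)⁻¹ * (C * q ^ K) with hρ
  have hρ0 : 0 ≤ ρ := by positivity
  let Y : ℝ → T → ℝ := fun x k => ξ * x ^ (k:ℕ)
  have hY : Measurable Y := by
    refine measurable_pi_lambda _ fun k => ?_
    simp only [Y]; fun_prop
  have hcard : Fintype.card T = T.card := Fintype.card_coe T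
  have hmom : ∀ m ≤ M, |(∫ x, (∑ k, g (Y x k)) ^ m ∂(intM A B))
      - ∫ u, (∑ k, g (u k)) ^ m ∂(Measure.pi fun _ : T => unitM)| ≤ (N * (2 * J + 1)) ^ M * ρ := by
    intro m hm
    have h1 := moment_cmp (intM A B) Y hY unitM (fun j hj => by
        rw [unitM_int]; exact ech_int j hj) g J (fco f) (fco_le_one f hper hint hvar)
        (fun y => fg_eq f J y) m ρ hρ0 (by
      intro w hw hwm
      set s := Finset.univ.filter (fun k : T => w k ≠ 0) with hs
      have h2 := hosc K hK T s (fun k => (k:ℕ)) (fun k => (w k : ℝ)) (by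
        obtain ⟨k, hk⟩ := Function.ne_iff.1 hw
        exact ⟨k, by simpa [hs] using hk⟩) (hwm.trans hm) (fun a _ b _ hab => Subtype.ext hab)
        (fun k _ => hTK k k.2) (fun k hk => by
          have : w k ≠ 0 := (Finset.mem_filter.1 hk).2
          exact_mod_cast Int.one_le_abs this)
      rw [intM_int A B hAB, norm_smul, Real.norm_of_nonneg hBA.le, hρ]
      refine mul_le_mul_of_nonneg_left (le_trans (le_of_eq ?_) h2) hBA.le
      congr 2; ext x
      unfold tchi
      congr 3
      rw [hs, Finset.sum_filter, mul_assoc, mul_assoc, mul_assoc, Finset.mul_sum (a := ξ)]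
      congr 2
      refine Finset.sum_congr rfl fun k _ => ?_
      simp only [Y]
      split_ifs with h0
      · ring
      · have : w k = 0 := by simpa using h0
        simp [this])
    refine h1.trans ?_
    refine mul_le_mul_of_nonneg_right ?_ hρ0
    have hb1 : (1:ℝ) ≤ N * (2 * J + 1) := by
      have h3 : (1:ℝ) ≤ N := by exact_mod_cast hN
      have h4 : (0:ℝ) ≤ J := Nat.cast_nonneg J
      nlinarith
    calc ((Fintype.card T : ℝ) * (2 * J + 1)) ^ m ≤ (N * (2 * J + 1)) ^ m := by
          have : (Fintype.card T : ℝ) ≤ N := by rw [hcard]; exact_mod_cast hT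
          gcongr
      _ ≤ _ := pow_le_pow_right₀ hb1 hm
  have hbd : ∀ u : T → ℝ, |h * ∑ k, g (u k)| ≤ 1 * ∑ k : T, S := by
    intro u
    rw [abs_mul]
    refine mul_le_mul hh1 ((Finset.abs_sum_le_sum_abs _ _).trans (Finset.sum_le_sum fun k _ => hS _)) (abs_nonneg _) zero_le_one
  have hmg : Measurable (fun u : T → ℝ => h * ∑ k, g (u k)) := by fun_prop
  have hcmp := char_cmp (intM A B) (Measure.pi fun _ : T => unitM) (fun x => h * ∑ k, g (Y x k))
    (fun u => h * ∑ k, g (u k)) (hmg.comp hY) hmg (1 * ∑ k : T, S) (fun x => hbd (Y x)) hbd M hM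
    ((N * (2 * J + 1)) ^ M * ρ) (by
      intro m hm
      simp only [mul_pow]
      rw [integral_const_mul, integral_const_mul, ← mul_sub, abs_mul, abs_pow]
      have h3 : |h| ^ m ≤ 1 := pow_le_one₀ (abs_nonneg _) hh1
      have h4 := hmom m hm
      rw [mul_pow] at h4
      have h5 := mul_le_mul h3 h4 (abs_nonneg _) zero_le_one
      rw [one_mul] at h5
      exact h5)
  have hE1 := exp_bound g hgm S V h hS hhS (by rw [unitM_int]; exact fg_int f hint J) hV T N (by rw [hcard]; exact hT)
  have hE2 := exp_bound g hgm S V (-h) hS (by rwa [abs_neg]) (by rw [unitM_int]; exact fg_int f hint J) hV T N (by rw [hcard]; exact hT)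
  have e2 : ∀ u : T → ℝ, Real.exp (2 * (-h * ∑ k, g (u k))) = Real.exp (-(2 * (h * ∑ k, g (u k)))) := by
    intro u; congr 1; ring
  simp only [e2, neg_sq] at hE2
  have e3 : ∫ u, Complex.exp (Complex.I * ((h * ∑ k, g (u k) : ℝ) : ℂ)) ∂(Measure.pi fun _ : T => unitM)
      = (∫ u, Complex.exp (Complex.I * ((h * g u : ℝ) : ℂ)) ∂unitM) ^ T.card := by
    rw [← hcard, ← integral_fintype_prod_eq_pow (fun u => Complex.exp (Complex.I * ((h * g u : ℝ) : ℂ)))]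
    congr 1; ext u
    rw [← Complex.exp_sum, ← Finset.mul_sum]
    congr 2
    rw [← Complex.ofReal_sum, ← Finset.mul_sum]
  have e4 : ∀ x, ∑ k, g (Y x k) = ∑ k ∈ T, g (ξ * x ^ k) := by
    intro x
    rw [← Finset.sum_coe_sort T]
  simp only [e4] at hcmp
  rw [e3] at hcmp
  refine hcmp.trans ?_
  have : (2:ℝ)⁻¹ ^ M * ((∫ u : T → ℝ, Real.exp (2 * (h * ∑ k, g (u k))) ∂(Measure.pi fun _ : T => unitM))
     + ∫ u : T → ℝ, Real.exp (-(2 * (h * ∑ k, g (u k)))) ∂(Measure.pi fun _ : T => unitM))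
     ≤ 2⁻¹ ^ M * (2 * Real.exp (4 * h ^ 2 * V * N)) := by
    refine mul_le_mul_of_nonneg_left ?_ (by positivity)
    linarith
  linarith


def Kf (N : ℕ) : ℕ := Nat.sqrt (Nat.sqrt N)

lemma Kf_tendsto : Tendsto Kf atTop atTop := by
  have h : Tendsto Nat.sqrt atTop atTop := by
    refine tendsto_atTop_atTop.2 fun b => ⟨b * b, fun a ha => Nat.le_sqrt.2 ha⟩
  exact h.comp h

lemma Kf_pow_le (N : ℕ) : Kf N ^ 4 ≤ N := by
  have h1 : Kf N ^ 2 ≤ Nat.sqrt N := Nat.sqrt_le' _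
  have h2 : Nat.sqrt N ^ 2 ≤ N := Nat.sqrt_le' _
  calc Kf N ^ 4 = (Kf N ^ 2) ^ 2 := by ring
    _ ≤ Nat.sqrt N ^ 2 := Nat.pow_le_pow_left h1 2
    _ ≤ N := h2

lemma Kf_lt (N : ℕ) : N ≤ (Kf N + 1) ^ 4 := by
  have h1 : Nat.sqrt N < (Kf N + 1) ^ 2 := Nat.lt_succ_sqrt' _
  have h2 : N < (Nat.sqrt N + 1) ^ 2 := Nat.lt_succ_sqrt' _
  calc N ≤ (Nat.sqrt N + 1) ^ 2 := h2.le
    _ ≤ ((Kf N + 1) ^ 2) ^ 2 := Nat.pow_le_pow_left h1 2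
    _ = _ := by ring

lemma Kf_div : Tendsto (fun N => (Kf N : ℝ) / Real.sqrt N) atTop (nhds 0) := by
  have h1 : Tendsto (fun N => 1 / (Kf N : ℝ)) atTop (nhds 0) :=
    (tendsto_natCast_atTop_atTop.comp Kf_tendsto).const_div_atTop 1
  refine squeeze_zero' (Eventually.of_forall fun N => by positivity) ?_ h1
  filter_upwards [Kf_tendsto.eventually_ge_atTop 1] with N hN
  have hK : (0:ℝ) < Kf N := by exact_mod_cast hN
  have h2 : (Kf N : ℝ) ^ 2 ≤ Real.sqrt N := by
    refine Real.le_sqrt_of_sq_le ?_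
    have := Kf_pow_le N
    rw [← pow_mul]; exact_mod_cast this
  rw [div_le_div_iff₀ (lt_of_lt_of_le (by positivity) h2) hK]
  nlinarith

lemma poly_decay (M : ℕ) (c q : ℝ) (hc : 0 ≤ c) (hq : 0 < q) (hq1 : q < 1) :
    Tendsto (fun N : ℕ => ((N:ℝ) * (2 * ((N^4:ℕ):ℝ) + 1)) ^ M * (c * q ^ (Kf N + 1))) atTop (nhds 0) := by
  have h1 := tendsto_pow_const_mul_const_pow_of_lt_one (20 * M) hq.le hq1
  have h2 : Tendsto (fun N => Kf N + 1) atTop atTop := (tendsto_add_atTop_nat 1).comp Kf_tendsto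
  have h3 := ((h1.comp h2).const_mul (3 ^ M * c))
  rw [mul_zero] at h3
  refine squeeze_zero' (Eventually.of_forall fun N => by positivity) ?_ h3
  filter_upwards [eventually_ge_atTop 1] with N hN
  have hN1 : (1:ℝ) ≤ N := by exact_mod_cast hN
  have h4 : (N:ℝ) ≤ ((Kf N + 1 : ℕ):ℝ) ^ 4 := by exact_mod_cast Kf_lt N
  set k : ℝ := ((Kf N + 1 : ℕ):ℝ)
  have hb : (N:ℝ) * (2 * ((N^4:ℕ):ℝ) + 1) ≤ 3 * k ^ 20 := by
    push_cast
    have h5 : (1:ℝ) ≤ (N:ℝ)^4 := one_le_pow₀ hN1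
    calc (N:ℝ) * (2 * (N:ℝ)^4 + 1) ≤ N * (3 * (N:ℝ)^4) := by gcongr; linarith
      _ = 3 * (N:ℝ)^5 := by ring
      _ ≤ 3 * (k^4)^5 := by gcongr
      _ = _ := by ring
  calc _ ≤ (3 * k ^ 20) ^ M * (c * q ^ (Kf N + 1)) := by gcongr
    _ = 3 ^ M * c * (k ^ (20 * M) * q ^ (Kf N + 1)) := by
        rw [mul_pow, ← pow_mul]; ring

lemma step1 (f : ℝ → ℝ) (hper : ∀ x : ℝ, f (x + 1) = f x)
    (hint : (∫ x in (0:ℝ)..1, f x) = 0)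
    (hvar : eVariationOn f (Set.Icc (0:ℝ) 1) ≤ 2)
    (s : ℕ → ℕ) (hpos : ∀ n, 1 ≤ n → 1 ≤ s n)
    (ξ : ℝ) (hξ : 0 < ξ) (A B : ℝ) (hA : 1 < A) (hAB : A < B) (N : ℕ) (h : ℝ)
    (C₁ D : ℝ) (hC₁ : ∀ y, |fg f (N ^ 4) y| ≤ C₁) (hD : ∫ x in (0:ℝ)..1, |f x - fg f (N ^ 4) x| ≤ D)
    (G : Finset ℕ) (hG : G ⊆ Finset.Icc 1 N) (K : ℕ) (hK : (Finset.Icc 1 N \ G).card ≤ K) :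
    ‖(∫ x, Complex.exp (Complex.I * ((h * ∑ n ∈ Finset.Icc 1 N, f (ξ * x ^ s n) : ℝ) : ℂ)) ∂(intM A B))
      - ∫ x, Complex.exp (Complex.I * ((h * ∑ n ∈ G, fg f (N^4) (ξ * x ^ s n) : ℝ) : ℂ)) ∂(intM A B)‖
     ≤ |h| * (2 * K + N * ((B - A)⁻¹ * ((1 / ξ + (B - A)) * D))) := by
  have := intM_prob A B hAB
  have hm := f_meas f hper hvar
  have hb := f_bdd f hper hint hvar
  set g := fg f (N^4) with hg
  have hgm : Measurable g := (fg_cont f _).measurable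
  have hBA : 0 < (B - A)⁻¹ := inv_pos.2 (by linarith)
  have hpt : ∀ x, |(∑ n ∈ Finset.Icc 1 N, f (ξ * x ^ s n)) - ∑ n ∈ G, g (ξ * x ^ s n)|
      ≤ 2 * K + ∑ n ∈ G, |f (ξ * x ^ s n) - g (ξ * x ^ s n)| := by
    intro x
    rw [← Finset.sum_sdiff hG, add_sub_assoc, ← Finset.sum_sub_distrib]
    refine (abs_add_le _ _).trans (add_le_add ?_ (Finset.abs_sum_le_sum_abs _ _))
    refine (Finset.abs_sum_le_sum_abs _ _).trans ?_
    refine (Finset.sum_le_sum fun n _ => hb _).trans ?_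
    rw [Finset.sum_const, nsmul_eq_mul, mul_comm]
    have : ((Finset.Icc 1 N \ G).card : ℝ) ≤ K := by exact_mod_cast hK
    linarith
  have hfg : ∀ y, |f y - g y| ≤ 2 + C₁ := fun y => (abs_sub _ _).trans (add_le_add (hb y) (hC₁ y))
  have hd : ∀ n ∈ G, Integrable (fun x => |f (ξ * x ^ s n) - g (ξ * x ^ s n)|) (intM A B) := by
    intro n _
    refine integrable_of_bdd _ _ (Measurable.aestronglyMeasurable (by fun_prop)) (2 + C₁) fun x => ?_
    rw [Real.norm_eq_abs, abs_abs]; exact hfg _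
  have hd1 : ∀ n ∈ G, ∫ x, |f (ξ * x ^ s n) - g (ξ * x ^ s n)| ∂(intM A B) ≤ (B - A)⁻¹ * ((1 / ξ + (B - A)) * D) := by
    intro n hn
    rw [intM_int A B hAB, smul_eq_mul]
    refine mul_le_mul_of_nonneg_left ?_ hBA.le
    have hn1 := (Finset.mem_Icc.1 (hG hn)).1
    have h1 := density (fun y => |f y - g y|) (by fun_prop) (fun y => abs_nonneg _) (2 + C₁) hfg
      (fun x => by simp only [hper, hg, fg_per]) (s n) (hpos n hn1) ξ A B hξ hA hAB
    refine h1.trans (mul_le_mul_of_nonneg_left hD ?_)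
    have : 0 < B - A := by linarith
    positivity
  have hD0 : 0 ≤ D := le_trans (intervalIntegral.integral_nonneg zero_le_one (fun x _ => abs_nonneg _)) hD
  have hi2 : Integrable (fun x => ∑ n ∈ G, |f (ξ * x ^ s n) - g (ξ * x ^ s n)|) (intM A B) :=
    integrable_finsetSum _ hd
  have hlip := charint_lip (intM A B) (fun x => h * ∑ n ∈ Finset.Icc 1 N, f (ξ * x ^ s n))
    (fun x => h * ∑ n ∈ G, g (ξ * x ^ s n)) (by fun_prop) (by fun_prop) (|h| * (2 * K + ∑ n ∈ G, (2 + C₁))) (by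
      intro x
      rw [← mul_sub, abs_mul]
      refine mul_le_mul_of_nonneg_left ((hpt x).trans ?_) (abs_nonneg _)
      gcongr with n hn
      exact hfg _)
  refine hlip.trans ?_
  simp only [← mul_sub, abs_mul]
  rw [integral_const_mul]
  refine mul_le_mul_of_nonneg_left ?_ (abs_nonneg _)
  calc _ ≤ ∫ x, (2 * (K:ℝ) + ∑ n ∈ G, |f (ξ * x ^ s n) - g (ξ * x ^ s n)|) ∂(intM A B) := by
        refine integral_mono_of_nonneg (ae_of_all _ fun _ => abs_nonneg _) ?_ (ae_of_all _ hpt)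
        exact (integrable_const _).add hi2
    _ = 2 * K + ∑ n ∈ G, ∫ x, |f (ξ * x ^ s n) - g (ξ * x ^ s n)| ∂(intM A B) := by
        rw [integral_add (integrable_const _) hi2, integral_finsetSum _ hd]; simp
    _ ≤ 2 * K + ∑ n ∈ G, (B - A)⁻¹ * ((1 / ξ + (B - A)) * D) := by
        gcongr with n hn; exact hd1 n hn
    _ ≤ _ := by
        rw [Finset.sum_const, nsmul_eq_mul]
        have : (G.card : ℝ) ≤ N := by
          have := Finset.card_le_card hG
          simp at this; exact_mod_cast this
        have : 0 < B - A := by linarith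
        gcongr


lemma char_lim (f : ℝ → ℝ) (hper : ∀ x : ℝ, f (x + 1) = f x)
    (hint : (∫ x in (0:ℝ)..1, f x) = 0)
    (hvar : eVariationOn f (Set.Icc (0:ℝ) 1) ≤ 2)
    (σ : ℝ) (hσdef : σ = Real.sqrt (∫ x in (0:ℝ)..1, (f x) ^ 2)) (hσ : 0 < σ)
    (s : ℕ → ℕ) (hinj : ∀ m n : ℕ, 1 ≤ m → 1 ≤ n → s m = s n → m = n)
    (hpos : ∀ n, 1 ≤ n → 1 ≤ s n)
    (ξ : ℝ) (hξ : 0 < ξ) (A B : ℝ) (hA : 1 < A) (hAB : A < B) (θ : ℝ) :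
    Tendsto (fun N : ℕ => ∫ x, Complex.exp (Complex.I *
      ((θ / (σ * Real.sqrt N) * ∑ n ∈ Finset.Icc 1 N, f (ξ * x ^ s n) : ℝ) : ℂ)) ∂(intM A B))
      atTop (nhds (Complex.exp (-(θ:ℂ) ^ 2 / 2))) := by
  obtain ⟨C₁, hC₁, hsup⟩ := fg_sup f hper hint hvar
  obtain ⟨C₂, hC₂, hL2⟩ := fg_L2 f hper hint hvar
  obtain ⟨D, hD, hL1⟩ := fg_L1 f hper hint hvar
  have hm := f_meas f hper hvar
  have hb := f_bdd f hper hint hvar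
  have hBA : 0 < B - A := by linarith
  set h : ℕ → ℝ := fun N => θ / (σ * Real.sqrt N) with hh
  set G : ℕ → Finset ℕ := fun N => (Finset.Icc 1 N).filter (fun n => Kf N < s n) with hG
  have hGsub : ∀ N, G N ⊆ Finset.Icc 1 N := fun N => Finset.filter_subset _ _
  have hbad : ∀ N, (Finset.Icc 1 N \ G N).card ≤ Kf N := by
    intro N
    have : (Finset.Icc 1 N \ G N).card ≤ (Finset.Icc 1 (Kf N)).card := by
      refine Finset.card_le_card_of_injOn s ?_ ?_
      · intro n hn
        simp only [hG, Finset.coe_sdiff, Set.mem_sdiff, Finset.mem_coe, Finset.mem_filter, Finset.mem_Icc, not_and, not_lt] at hn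
        rw [Finset.mem_coe, Finset.mem_Icc]
        exact ⟨hpos n hn.1.1, hn.2 hn.1⟩
      · intro a ha b hb hab
        simp only [Finset.coe_sdiff, Set.mem_sdiff, Finset.mem_coe, Finset.mem_Icc] at ha hb
        exact hinj a b ha.1.1 hb.1.1 hab
    simpa using this
  have hsinj : ∀ N, Set.InjOn s (G N) := by
    intro N a ha b hb hab
    have ha1 := (Finset.mem_Icc.1 (hGsub N ha)).1
    have hb1 := (Finset.mem_Icc.1 (hGsub N hb)).1
    exact hinj a b ha1 hb1 hab
  set T : ℕ → Finset ℕ := fun N => (G N).image s with hT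
  have hTcard : ∀ N, (T N).card = (G N).card := fun N => Finset.card_image_of_injOn (hsinj N)
  have hGN : ∀ N, (G N).card ≤ N := by
    intro N
    have := Finset.card_le_card (hGsub N); simpa using this
  have hGK : ∀ N, N ≤ (T N).card + Kf N := by
    intro N
    have h1 := Finset.card_sdiff_add_card_eq_card (hGsub N)
    have h2 := hbad N
    rw [Nat.card_Icc] at h1
    rw [hTcard]; omega
  have hmodel := model_lim f hper hint hvar σ hσdef hσ θ (fun N => (T N).card) Kf
    (fun N => by rw [hTcard]; exact hGN N) hGK Kf_div
  set a : ℕ → ℂ := fun N => ∫ x, Complex.exp (Complex.I *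
      ((θ / (σ * Real.sqrt N) * ∑ n ∈ Finset.Icc 1 N, f (ξ * x ^ s n) : ℝ) : ℂ)) ∂(intM A B) with ha
  set p : ℕ → ℂ := fun N => (∫ u, Complex.exp (Complex.I * ((θ / (σ * Real.sqrt N) * fg f (N^4) u : ℝ) : ℂ)) ∂unitM) ^ (T N).card with hp
  suffices hdiff : Tendsto (fun N => a N - p N) atTop (nhds 0) by
    have := hdiff.add hmodel
    rw [zero_add] at this
    refine this.congr fun N => ?_
    rw [sub_add_cancel]
  have hsqrt : Tendsto (fun N : ℕ => Real.sqrt N) atTop atTop :=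
    Real.tendsto_sqrt_atTop.comp tendsto_natCast_atTop_atTop
  have hh0 : Tendsto (fun N => |h N|) atTop (nhds 0) := by
    have h1 : Tendsto (fun N : ℕ => |θ| / σ / Real.sqrt N) atTop (nhds 0) := hsqrt.const_div_atTop _
    refine h1.congr fun N => ?_
    rw [hh, abs_div, abs_of_nonneg (by positivity : 0 ≤ σ * Real.sqrt N), div_div]
  -- err1
  set c₁ : ℝ := (B - A)⁻¹ * ((1 / ξ + (B - A)) * D) with hc₁
  have herr1 : ∀ N : ℕ, 1 ≤ N → ‖a N - ∫ x, Complex.exp (Complex.I * ((h N * ∑ k ∈ T N, fg f (N^4) (ξ * x ^ k) : ℝ) : ℂ)) ∂(intM A B)‖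
      ≤ |θ| / σ * (2 * (Kf N / Real.sqrt N)) + |h N| * c₁ := by
    intro N hN
    have hN0 : (0:ℝ) < N := by exact_mod_cast hN
    have h1 := step1 f hper hint hvar s hpos ξ hξ A B hA hAB N (h N) _ (D / N) (hsup N) (hL1 N hN) (G N) (hGsub N) (Kf N) (hbad N)
    have e1 : ∀ x : ℝ, ∑ k ∈ T N, fg f (N^4) (ξ * x ^ k) = ∑ n ∈ G N, fg f (N^4) (ξ * x ^ s n) := by
      intro x; rw [hT, Finset.sum_image (hsinj N)]
    simp only [e1]
    refine h1.trans (le_of_eq ?_)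
    have e2 : |h N| = |θ| / σ / Real.sqrt N := by
      rw [hh, abs_div, abs_of_nonneg (by positivity : 0 ≤ σ * Real.sqrt N), div_div]
    have e3 : (N:ℝ) * ((B - A)⁻¹ * ((1 / ξ + (B - A)) * (D / N))) = c₁ := by
      rw [hc₁]; field_simp
    rw [e3, mul_add, e2]; ring
  have hz1 : Tendsto (fun N => |θ| / σ * (2 * (Kf N / Real.sqrt N)) + |h N| * c₁) atTop (nhds 0) := by
    have := ((Kf_div.const_mul 2).const_mul (|θ| / σ)).add (hh0.mul_const c₁)
    simpa using this
  -- second moments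
  set V : ℝ := 8 + 2 * C₂ with hV
  have hVb : ∀ N : ℕ, 1 ≤ N → ∫ x, fg f (N^4) x ^ 2 ∂unitM ≤ V := by
    intro N hN
    have hN1 : (1:ℝ) ≤ N := by exact_mod_cast hN
    have hgm : Measurable (fg f (N^4)) := (fg_cont f _).measurable
    have hi1 : Integrable (fun x => (f x - fg f (N^4) x)^2) unitM := by
      refine integrable_of_bdd unitM _ (Measurable.aestronglyMeasurable (by fun_prop)) ((2 + C₁ * (N:ℝ) ^ (1/4:ℝ))^2) fun x => ?_
      rw [norm_pow, Real.norm_eq_abs]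
      have : |f x - fg f (N^4) x| ≤ 2 + C₁ * (N:ℝ) ^ (1/4:ℝ) := (abs_sub _ _).trans (add_le_add (hb x) (hsup N x))
      gcongr
    calc ∫ x, fg f (N^4) x ^ 2 ∂unitM ≤ ∫ x, (8 + 2 * (f x - fg f (N^4) x)^2) ∂unitM := by
          refine integral_mono_of_nonneg (ae_of_all _ fun _ => sq_nonneg _) ((integrable_const _).add (hi1.const_mul _)) (ae_of_all _ fun x => ?_)
          simp only
          have h1 : f x ^ 2 ≤ 4 := by
            have := abs_le.1 (hb x); nlinarith
          nlinarith [sq_nonneg (2 * f x - fg f (N^4) x)]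
      _ = 8 + 2 * ∫ x in (0:ℝ)..1, (f x - fg f (N^4) x)^2 := by
          rw [integral_add (integrable_const _) (hi1.const_mul _), integral_const_mul]; simp; exact unitM_int _
      _ ≤ 8 + 2 * (C₂ / (N:ℝ)^2) := by have := hL2 N hN; gcongr
      _ ≤ V := by
          have : C₂ / (N:ℝ)^2 ≤ C₂ := div_le_self hC₂ (one_le_pow₀ hN1)
          rw [hV]; linarith
  have hsmall : Tendsto (fun N : ℕ => 2 * |h N| * (C₁ * (N:ℝ) ^ (1/4:ℝ))) atTop (nhds 0) := by
    have h1 := (tendsto_rpow_neg_atTop (y := 1/4) (by norm_num)).comp (tendsto_natCast_atTop_atTop (R := ℝ))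
    have h2 := h1.const_mul (2 * (|θ| / σ) * C₁)
    rw [mul_zero] at h2
    refine h2.congr' ?_
    filter_upwards [eventually_ge_atTop 1] with N hN
    have hN0 : (0:ℝ) < N := by exact_mod_cast hN
    have e2 : |h N| = |θ| / σ / Real.sqrt N := by
      rw [hh, abs_div, abs_of_nonneg (by positivity : 0 ≤ σ * Real.sqrt N), div_div]
    have e3 : (N:ℝ) ^ (-(1/4):ℝ) = (N:ℝ) ^ (1/4:ℝ) / Real.sqrt N := by
      rw [Real.sqrt_eq_rpow, ← Real.rpow_sub hN0]; norm_num
    simp only [Function.comp]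
    rw [e2, e3]; ring
  set E : ℝ := Real.exp (4 * (θ / σ) ^ 2 * V) with hE
  rw [Metric.tendsto_atTop']
  intro ε hε
  -- choose M
  have hMlim : Tendsto (fun m : ℕ => 2 * ((2:ℝ)⁻¹ ^ m * (2 * E))) atTop (nhds 0) := by
    have := ((tendsto_pow_atTop_nhds_zero_of_lt_one (by norm_num : (0:ℝ) ≤ 2⁻¹) (by norm_num)).mul_const (2 * E)).const_mul 2
    simpa using this
  obtain ⟨m, hm'⟩ := (hMlim.eventually (gt_mem_nhds (show (0:ℝ) < ε / 3 by positivity))).exists_forall_of_atTop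
  set M := 2 * m with hMdef
  have hMε : 2 * ((2:ℝ)⁻¹ ^ M * (2 * E)) < ε / 3 := hm' M (by omega)
  obtain ⟨C, q, hC, hq, hq1, hosc⟩ := osc_bound M ξ A B hξ hA hAB
  have hz2 := (poly_decay M ((B - A)⁻¹ * C) q (by positivity) hq hq1).const_mul ((M:ℝ) + 1)
  rw [mul_zero] at hz2
  have hev : ∀ᶠ N in atTop, dist (a N - p N) 0 < ε := by
    filter_upwards [eventually_ge_atTop 1, Kf_tendsto.eventually_ge_atTop 1,
      hz1.eventually (gt_mem_nhds (show (0:ℝ) < ε / 3 by positivity)),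
      hz2.eventually (gt_mem_nhds (show (0:ℝ) < ε / 3 by positivity)),
      hh0.eventually (gt_mem_nhds (show (0:ℝ) < 1 by norm_num)),
      hsmall.eventually (gt_mem_nhds (show (0:ℝ) < 1 by norm_num))] with N hN hKN h1 h2 h3 h4
    have hN0 : (0:ℝ) < N := by exact_mod_cast hN
    have hs2 := step2 f hper hint hvar ξ A B hAB (N^4) N (Kf N + 1) M ⟨m, by omega⟩ hN (by omega) C q hC hq hosc (T N)
      (by rw [hTcard]; exact hGN N) (by
        intro k hk
        obtain ⟨n, hn, rfl⟩ := Finset.mem_image.1 hk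
        exact (Finset.mem_filter.1 hn).2) (h N) (C₁ * (N:ℝ) ^ (1/4:ℝ)) V h3.le (hsup N) h4.le (hVb N hN)
    have e5 : 4 * h N ^ 2 * V * N = 4 * (θ / σ) ^ 2 * V := by
      rw [hh]
      simp only [div_pow, mul_pow]
      rw [Real.sq_sqrt hN0.le]
      field_simp
    rw [e5] at hs2
    have e6 : (M + 1 : ℝ) * (((N:ℝ) * (2 * ((N^4:ℕ):ℝ) + 1)) ^ M * ((B - A)⁻¹ * (C * q ^ (Kf N + 1))))
      = (M + 1) * (((N:ℝ) * (2 * ((N^4:ℕ):ℝ) + 1)) ^ M * ((B - A)⁻¹ * C * q ^ (Kf N + 1))) := by ring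
    rw [e6] at hs2
    have hs1 := herr1 N hN
    rw [dist_zero_right]
    have h5 := norm_sub_le_norm_sub_add_norm_sub (a N)
      (∫ x, Complex.exp (Complex.I * ((h N * ∑ k ∈ T N, fg f (N^4) (ξ * x ^ k) : ℝ) : ℂ)) ∂(intM A B)) (p N)
    refine lt_of_le_of_lt h5 ?_
    have hs2' := lt_of_le_of_lt hs2 (add_lt_add h2 hMε)
    have hs1' := lt_of_le_of_lt hs1 h1
    have e7 := add_lt_add hs1' hs2'
    have e8 : ε / 3 + (ε / 3 + ε / 3) = ε := by ring
    rw [e8] at e7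
    exact e7
  obtain ⟨N₀, hN₀⟩ := eventually_atTop.1 hev
  exact ⟨N₀, fun n hn => hN₀ n hn.le⟩


lemma polya (F : ℕ → ℝ → ℝ) (Φ : ℝ → ℝ) (hF : ∀ N, Monotone (F N)) (h0 : ∀ N t, 0 ≤ F N t)
    (h1 : ∀ N t, F N t ≤ 1) (hΦ : Monotone Φ) (hc : Continuous Φ) (hbot : Tendsto Φ atBot (nhds 0))
    (htop : Tendsto Φ atTop (nhds 1)) (hpt : ∀ t, Tendsto (fun N => F N t) atTop (nhds (Φ t))) :
    TendstoUniformly F Φ atTop := by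
  rw [Metric.tendstoUniformly_iff]
  intro ε hε
  obtain ⟨m, hm⟩ := exists_nat_gt (3 / ε)
  have hm0 : (0:ℝ) < m := lt_trans (by positivity) hm
  have hmε : 3 / m < ε := by
    rw [div_lt_iff₀ hε] at hm; rw [div_lt_iff₀ hm0]; linarith
  have hΦ0 : ∀ t, 0 ≤ Φ t := fun t => ge_of_tendsto' (hpt t) (fun N => h0 N t)
  have hΦ1 : ∀ t, Φ t ≤ 1 := fun t => le_of_tendsto' (hpt t) (fun N => h1 N t)
  have hx : ∀ j : ℕ, ∃ x, 0 < j → j < m → Φ x = j / m := by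
    intro j
    by_cases hj : 0 < j ∧ j < m
    · have hj0 : (0:ℝ) < j / m := by
        have : (0:ℝ) < j := by exact_mod_cast hj.1
        positivity
      have hj1 : (j:ℝ) / m < 1 := by
        rw [div_lt_one hm0]; exact_mod_cast hj.2
      obtain ⟨a, ha⟩ := (hbot.eventually (gt_mem_nhds hj0)).exists
      obtain ⟨b, hb⟩ := (htop.eventually (lt_mem_nhds hj1)).exists
      obtain ⟨x, hx⟩ := mem_range_of_exists_le_of_exists_ge hc ⟨a, ha.le⟩ ⟨b, hb.le⟩
      exact ⟨x, fun _ _ => hx⟩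
    · exact ⟨0, fun h2 h3 => absurd ⟨h2, h3⟩ hj⟩
  choose x hx using hx
  have hev : ∀ᶠ N in atTop, ∀ j ∈ Finset.range m, |F N (x j) - Φ (x j)| < 1 / m := by
    rw [Filter.eventually_all_finset]
    intro j _
    have := Metric.tendsto_nhds.1 (hpt (x j)) (1 / m) (by positivity)
    simpa only [Real.dist_eq] using this
  filter_upwards [hev] with N hN t
  rw [Real.dist_eq]
  refine lt_of_le_of_lt ?_ hmε
  set i := ⌊(m:ℝ) * Φ t⌋₊ with hi
  have hi1 : (i:ℝ) ≤ m * Φ t := Nat.floor_le (mul_nonneg hm0.le (hΦ0 t))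
  have hi2 : (m:ℝ) * Φ t < i + 1 := Nat.lt_floor_add_one _
  have hscale : ∀ y z : ℝ, (m:ℝ) * y ≤ m * z → y ≤ z := fun y z h => le_of_mul_le_mul_left h hm0
  have hdiv : ∀ y : ℝ, (m:ℝ) * (y / m) = y := fun y => by field_simp
  -- upper
  have hup : (m:ℝ) * F N t ≤ i + 2 := by
    by_cases him : i + 1 < m
    · have hxi := hx (i+1) (by omega) him
      have hlt : t ≤ x (i+1) := by
        by_contra hcon
        push Not at hcon
        have := hΦ hcon.le
        rw [hxi] at this
        have h5 := mul_le_mul_of_nonneg_left this hm0.le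
        rw [hdiv] at h5
        push_cast at h5
        linarith
      have h6 := hF N hlt
      have h7 := (abs_lt.1 (hN (i+1) (Finset.mem_range.2 him))).2
      rw [hxi] at h7
      have h8 : F N t ≤ ((i:ℝ) + 2) / m := by
        have : ((i:ℝ) + 2) / m = ((i+1:ℕ):ℝ) / m + 1 / m := by push_cast; field_simp; ring
        rw [this]; linarith
      have h9 := mul_le_mul_of_nonneg_left h8 hm0.le
      rwa [hdiv] at h9
    · have : (m:ℝ) ≤ i + 1 := by exact_mod_cast (by omega : m ≤ i + 1)
      have := mul_le_mul_of_nonneg_left (h1 N t) hm0.le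
      linarith
  have hlo : (i:ℝ) - 2 ≤ m * F N t := by
    by_cases hi0 : 2 ≤ i
    · obtain ⟨l, hl⟩ : ∃ l, i = l + 1 := ⟨i - 1, by omega⟩
      rw [hl] at hi1 hi2 hi0
      rw [hl]
      have hlm : l < m := by
        have h3 : (m:ℝ) * Φ t ≤ m := by have := mul_le_mul_of_nonneg_left (hΦ1 t) hm0.le; linarith
        have : ((l+1:ℕ):ℝ) ≤ m := hi1.trans h3
        have : l + 1 ≤ m := by exact_mod_cast this
        omega
      have hxi := hx l (by omega) hlm
      have hlt : x l ≤ t := by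
        by_contra hcon
        push Not at hcon
        have := hΦ hcon.le
        rw [hxi] at this
        have h5 := mul_le_mul_of_nonneg_left this hm0.le
        rw [hdiv] at h5
        push_cast at hi1
        linarith
      have h6 := hF N hlt
      have h7 := (abs_lt.1 (hN l (Finset.mem_range.2 hlm))).1
      rw [hxi] at h7
      have h8 : ((l:ℝ) - 1) / m ≤ F N t := by
        have : ((l:ℝ) - 1) / m = (l:ℝ) / m - 1 / m := by rw [sub_div]
        rw [this]; linarith
      have h9 := mul_le_mul_of_nonneg_left h8 hm0.le
      rw [hdiv] at h9
      push_cast; linarith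
    · have : (i:ℝ) ≤ 2 := by exact_mod_cast (by omega : i ≤ 2)
      have := mul_nonneg hm0.le (h0 N t)
      linarith
  rw [abs_le]
  constructor
  · refine hscale _ _ ?_
    rw [mul_neg, hdiv, mul_sub]; linarith
  · refine hscale _ _ ?_
    rw [hdiv, mul_sub]; linarith

lemma gauss_pdf (u : ℝ) : Real.exp (-u ^ 2 / 2) / Real.sqrt (2 * Real.pi) = ProbabilityTheory.gaussianPDFReal 0 1 u := by
  simp [ProbabilityTheory.gaussianPDFReal]; ring

lemma std_eq (t : ℝ) : stdNormalCDF t = (ProbabilityTheory.gaussianReal 0 1).real (Set.Iic t) := by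
  unfold stdNormalCDF
  simp only [gauss_pdf]
  rw [Measure.real, ProbabilityTheory.gaussianReal_apply_eq_integral 0 one_ne_zero, ENNReal.toReal_ofReal]
  exact integral_nonneg fun x => ProbabilityTheory.gaussianPDFReal_nonneg _ _ _

lemma std_cdf : stdNormalCDF = (ProbabilityTheory.cdf (ProbabilityTheory.gaussianReal 0 1) : ℝ → ℝ) := by
  ext t; rw [std_eq, ProbabilityTheory.cdf_eq_real]

lemma std_cont : Continuous stdNormalCDF := by
  have hi : Integrable (fun u => Real.exp (-u ^ 2 / 2) / Real.sqrt (2 * Real.pi)) volume := by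
    simp only [gauss_pdf]
    exact ProbabilityTheory.integrable_gaussianPDFReal 0 1
  rw [continuous_iff_continuousAt]
  intro t
  have : ContinuousOn stdNormalCDF (Set.Iic (t + 1)) :=
    hi.integrableOn.continuousOn_Iic_primitive_Iic
  exact this.continuousAt (Iic_mem_nhds (by linarith))

theorem stmt2 (f : ℝ → ℝ) (hper : ∀ x : ℝ, f (x + 1) = f x)
    (hint : (∫ x in (0:ℝ)..1, f x) = 0)
    (hvar : eVariationOn f (Set.Icc (0:ℝ) 1) ≤ 2)
    (σ : ℝ) (hσdef : σ = Real.sqrt (∫ x in (0:ℝ)..1, (f x) ^ 2)) (hσ : 0 < σ)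
    (s : ℕ → ℕ) (hinj : ∀ m n : ℕ, 1 ≤ m → 1 ≤ n → s m = s n → m = n)
    (hpos : ∀ n, 1 ≤ n → 1 ≤ s n)
    (ξ : ℝ) (hξ : 0 < ξ) (A B : ℝ) (hA : 1 < A) (hAB : A < B) :
    TendstoUniformly
      (fun (N : ℕ) (t : ℝ) =>
        (volume {x ∈ Set.Icc A B |
            (∑ n ∈ Finset.Icc 1 N, f (ξ * x ^ s n)) / (σ * Real.sqrt N) ≤ t}).toReal
          / (B - A))
      stdNormalCDF Filter.atTop := by
  have hprob := intM_prob A B hAB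
  have hm := f_meas f hper hvar
  set X : ℕ → ℝ → ℝ := fun N x => (∑ n ∈ Finset.Icc 1 N, f (ξ * x ^ s n)) / (σ * Real.sqrt N) with hX
  have hXm : ∀ N, Measurable (X N) := by
    intro N; simp only [hX]; fun_prop
  have hmp : ∀ N, IsProbabilityMeasure ((intM A B).map (X N)) := fun N =>
    Measure.isProbabilityMeasure_map (hXm N).aemeasurable
  have key : (fun (N : ℕ) (t : ℝ) =>
        (volume {x ∈ Set.Icc A B | X N x ≤ t}).toReal / (B - A))
      = fun N t => ((intM A B).map (X N)).real (Set.Iic t) := by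
    ext N t
    rw [Measure.real, Measure.map_apply (hXm N) measurableSet_Iic, intM, Measure.smul_apply, smul_eq_mul,
      ENNReal.toReal_mul, ENNReal.toReal_inv, ENNReal.toReal_ofReal (by linarith),
      Measure.restrict_apply (hXm N measurableSet_Iic), div_eq_inv_mul]
    congr 3
    ext x
    simp [and_comm]
  change TendstoUniformly (fun (N : ℕ) (t : ℝ) =>
        (volume {x ∈ Set.Icc A B | X N x ≤ t}).toReal / (B - A)) _ _
  rw [key]
  let P : ℕ → ProbabilityMeasure ℝ := fun N => ⟨(intM A B).map (X N), hmp N⟩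
  let P₀ : ProbabilityMeasure ℝ := ⟨ProbabilityTheory.gaussianReal 0 1, inferInstance⟩
  have hweak : Tendsto P atTop (nhds P₀) := by
    refine ProbabilityMeasure.tendsto_iff_tendsto_charFun.2 fun θ => ?_
    change Tendsto (fun N => charFun ((intM A B).map (X N)) θ) atTop
      (nhds (charFun (ProbabilityTheory.gaussianReal 0 1) θ))
    have h1 := char_lim f hper hint hvar σ hσdef hσ s hinj hpos ξ hξ A B hA hAB θ
    rw [ProbabilityTheory.charFun_gaussianReal]
    have e0 : (θ:ℂ) * ((0:ℝ):ℂ) * Complex.I - ((1:NNReal):ℝ) * (θ:ℂ) ^ 2 / 2 = -(θ:ℂ) ^ 2 / 2 := by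
      push_cast; ring
    rw [e0]
    refine h1.congr fun N => ?_
    rw [charFun_apply_real, integral_map (hXm N).aemeasurable (by fun_prop)]
    congr 1; ext x
    congr 1
    simp only [hX]
    push_cast
    ring
  refine polya _ _ ?_ ?_ ?_ ?_ std_cont ?_ ?_ ?_
  · intro N a b hab
    exact measureReal_mono (Set.Iic_subset_Iic.2 hab)
  · intro N t; exact measureReal_nonneg
  · intro N t; exact measureReal_le_one
  · rw [std_cdf]; exact ProbabilityTheory.monotone_cdf _
  · rw [std_cdf]; exact ProbabilityTheory.tendsto_cdf_atBot _
  · rw [std_cdf]; exact ProbabilityTheory.tendsto_cdf_atTop _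
  · intro t
    have hna := ProbabilityTheory.nullSingletonClass_gaussianReal (μ := 0) (v := 1) one_ne_zero
    have h2 := ProbabilityMeasure.tendsto_measure_of_null_frontier_of_tendsto' hweak (E := Set.Iic t) (by
      rw [frontier_Iic]
      change ProbabilityTheory.gaussianReal 0 1 {t} = 0
      exact measure_singleton t)
    rw [std_eq]
    exact (ENNReal.tendsto_toReal (measure_ne_top _ _)).comp h2
end

section
/- Let ξ>0, let m ≠ n be positive integers, let j, k be positive integers, and let [α,β] be a subinterval of an interval [A,B] ⊂ (1,∞). Then |∫_α^β cos(2π ξ (j x^n + k x^m)) dx| ≤ 1/(ξ · max{m,n} · α^{max{m,n}−1}). -/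
open MeasureTheory

theorem vdc_aux (f p q : ℝ → ℝ) (a b : ℝ) (hab : a ≤ b)
    (hf : ∀ x, HasDerivAt f (p x) x) (hp : ∀ x, HasDerivAt p (q x) x)
    (hpos : ∀ x ∈ Set.Icc a b, 0 < p x) (hq : ∀ x ∈ Set.Icc a b, 0 ≤ q x) :
    |∫ x in a..b, Real.cos (f x)| ≤ 2 / p a := by
  have hd : ∀ c : ℝ, ∀ x ∈ Set.Icc a b, HasDerivAt (fun x => (Real.sin (f x) + c) / p x)
      (Real.cos (f x) - (Real.sin (f x) + c) * (q x / p x ^ 2)) x := by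
    intro c x hx
    have h := (((hf x).sin).add_const c).div (hp x) (hpos x hx).ne'
    have h0 := (hpos x hx).ne'
    refine h.congr_deriv ?_
    field_simp
  have hcf : Continuous f := continuous_iff_continuousAt.2 fun x => (hf x).continuousAt
  have hint : IntegrableOn (fun x => Real.cos (f x)) (Set.Icc a b) :=
    (Real.continuous_cos.comp hcf).continuousOn.integrableOn_Icc
  have hr : ∀ x ∈ Set.Icc a b, 0 ≤ q x / p x ^ 2 := fun x hx =>
    div_nonneg (hq x hx) (sq_nonneg _)
  have hpa := hpos a ⟨le_rfl, hab⟩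
  have hpb := hpos b ⟨hab, le_rfl⟩
  have up := intervalIntegral.integral_le_sub_of_hasDeriv_right_of_le hab
    (fun x hx => (hd (-1) x hx).continuousAt.continuousWithinAt)
    (fun x hx => (hd (-1) x (Set.Ioo_subset_Icc_self hx)).hasDerivWithinAt) hint
    (fun x hx => by
      have := hr x (Set.Ioo_subset_Icc_self hx)
      nlinarith [Real.sin_le_one (f x), mul_nonneg (sub_nonneg.2 (Real.sin_le_one (f x))) this])
  have lo := intervalIntegral.sub_le_integral_of_hasDeriv_right_of_le hab
    (fun x hx => (hd 1 x hx).continuousAt.continuousWithinAt)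
    (fun x hx => (hd 1 x (Set.Ioo_subset_Icc_self hx)).hasDerivWithinAt) hint
    (fun x hx => by
      have := hr x (Set.Ioo_subset_Icc_self hx)
      have h2 : 0 ≤ Real.sin (f x) + 1 := by linarith [Real.neg_one_le_sin (f x)]
      nlinarith [mul_nonneg h2 this])
  have e1 : (Real.sin (f b) + -1) / p b ≤ 0 :=
    div_nonpos_of_nonpos_of_nonneg (by linarith [Real.sin_le_one (f b)]) hpb.le
  have e2 : -(2 / p a) ≤ (Real.sin (f a) + -1) / p a := by
    rw [← neg_div]; gcongr; linarith [Real.neg_one_le_sin (f a)]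
  have e3 : 0 ≤ (Real.sin (f b) + 1) / p b :=
    div_nonneg (by linarith [Real.neg_one_le_sin (f b)]) hpb.le
  have e4 : (Real.sin (f a) + 1) / p a ≤ 2 / p a := by
    gcongr; linarith [Real.sin_le_one (f a)]
  rw [abs_le]
  constructor <;> linarith

theorem stmt4 (ξ A B α β : ℝ) (hξ : 0 < ξ) (hA : 1 < A)
    (hα : A ≤ α) (hαβ : α ≤ β) (hβ : β ≤ B)
    (m n : ℕ) (hm : 1 ≤ m) (hn : 1 ≤ n) (hmn : m ≠ n)
    (j k : ℕ) (hj : 1 ≤ j) (hk : 1 ≤ k) :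
    |∫ x in α..β, Real.cos (2 * Real.pi * ξ * (j * x ^ n + k * x ^ m))| ≤
      1 / (ξ * (max m n) * α ^ (max m n - 1)) := by
  have hα0 : 0 < α := by linarith
  have hπ := Real.pi_gt_three
  have hj' : (1 : ℝ) ≤ j := by exact_mod_cast hj
  have hk' : (1 : ℝ) ≤ k := by exact_mod_cast hk
  have hm' : (1 : ℝ) ≤ m := by exact_mod_cast hm
  have hn' : (1 : ℝ) ≤ n := by exact_mod_cast hn
  have key := vdc_aux (fun x => 2 * Real.pi * ξ * (j * x ^ n + k * x ^ m))
    (fun x => 2 * Real.pi * ξ * (j * (n * x ^ (n - 1)) + k * (m * x ^ (m - 1))))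
    (fun x => 2 * Real.pi * ξ * (j * (n * ((n - 1 : ℕ) * x ^ (n - 1 - 1)))
      + k * (m * ((m - 1 : ℕ) * x ^ (m - 1 - 1))))) α β hαβ
    (fun x => (((hasDerivAt_pow n x).const_mul _).add
      ((hasDerivAt_pow m x).const_mul _)).const_mul _)
    (fun x => (((((hasDerivAt_pow (n - 1) x).const_mul _).const_mul _).add
      (((hasDerivAt_pow (m - 1) x).const_mul _).const_mul _)).const_mul _))
    (fun x hx => by
      have : 0 < x := hα0.trans_le hx.1
      positivity)
    (fun x hx => by
      have : 0 < x := hα0.trans_le hx.1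
      positivity)
  refine key.trans ?_
  have hS : ((max m n : ℕ) : ℝ) * α ^ (max m n - 1) ≤
      j * (n * α ^ (n - 1)) + k * (m * α ^ (m - 1)) := by
    have h1 : 0 < n * α ^ (n - 1) := by positivity
    have h2 : 0 < m * α ^ (m - 1) := by positivity
    rcases le_total m n with h | h
    · rw [max_eq_right h]; nlinarith
    · rw [max_eq_left h]; nlinarith
  have hM : (0 : ℝ) < ((max m n : ℕ) : ℝ) * α ^ (max m n - 1) := by
    have : (0 : ℝ) < ((max m n : ℕ) : ℝ) := by
      exact_mod_cast lt_of_lt_of_le hm (le_max_left m n)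
    positivity
  rw [mul_assoc ξ, div_le_div_iff₀ (by positivity) (by positivity)]
  have h3 := mul_le_mul_of_nonneg_left hS hξ.le
  have h4 := mul_pos hξ hM
  generalize ξ * (((max m n : ℕ) : ℝ) * α ^ (max m n - 1)) = u at *
  rw [mul_assoc (2 * Real.pi)]
  generalize ξ * (j * (n * α ^ (n - 1)) + k * (m * α ^ (m - 1))) = v at *
  nlinarith
end

section
/- Let ξ>0, let m < n be positive integers, let j, k be positive integers, and let η>0. Then there exist three pairwise disjoint intervals I_1, I_2, I_3 ⊆ [A,B] such that the Lebesgue measure of [A,B] \ (I_1 ∪ I_2 ∪ I_3) is at most 2Bη, and such that for every interval [α,β] completely contained in one of I_1, I_2, I_3 one has |∫_α^β cos(2π ξ (j x^n − k x^m)) dx| ≤ 1/(ξ η m α^{m−1}). -/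
open MeasureTheory

lemma osc_aux (F F' u u' v v' : ℝ → ℝ) (α β U V : ℝ) (hαβ : α ≤ β)
    (hFc : Continuous F)
    (hF : ∀ x ∈ Set.Icc α β, HasDerivAt F (F' x) x)
    (hu : ∀ x ∈ Set.Icc α β, HasDerivAt u (u' x) x)
    (hv : ∀ x ∈ Set.Icc α β, HasDerivAt v (v' x) x)
    (hu0 : ∀ x ∈ Set.Icc α β, 0 ≤ u x) (huU : ∀ x ∈ Set.Icc α β, u x ≤ U)
    (hvV : ∀ x ∈ Set.Icc α β, |v x| ≤ V)
    (hu' : ∀ x ∈ Set.Icc α β, u' x ≤ 0) (hv' : ∀ x ∈ Set.Icc α β, v' x ≤ 0)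
    (h1 : ∀ x ∈ Set.Icc α β, F' x * (u x * v x) = 1) :
    |∫ x in α..β, Real.cos (F x)| ≤ 5 * (U * V) := by
  have hcc : Continuous fun x => Real.cos (F x) := Real.continuous_cos.comp hFc
  have hP : ∀ x ∈ Set.Icc α β, HasDerivAt
      (fun y => (∫ t in α..y, Real.cos (F t)) - Real.sin (F y) * (u y * v y))
      (- (Real.sin (F x) * (u' x * v x + u x * v' x))) x := by
    intro x hx
    have a := intervalIntegral.integral_hasDerivAt_right (hcc.intervalIntegrable α x)
      (hcc.stronglyMeasurableAtFilter _ _) hcc.continuousAt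
    have b := (hF x hx).sin.mul ((hu x hx).mul (hv x hx))
    refine (a.sub b).congr_deriv ?_
    simp only [Pi.mul_apply]
    linear_combination (-Real.cos (F x)) * h1 x hx
  have hD : ∀ x ∈ Set.Icc α β, HasDerivAt
      (fun y => -(V * u y) - U * v y) (-(V * u' x) - U * v' x) x := fun x hx =>
    (((hu x hx).const_mul V).neg).sub ((hv x hx).const_mul U)
  have hbd : ∀ x ∈ Set.Icc α β,
      |Real.sin (F x) * (u' x * v x + u x * v' x)| ≤ -(V * u' x) - U * v' x := by
    intro x hx
    have e1 : |u' x * v x| ≤ -(V * u' x) := by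
      rw [abs_mul, abs_of_nonpos (hu' x hx)]
      nlinarith [hvV x hx, hu' x hx]
    have e2 : |u x * v' x| ≤ -(U * v' x) := by
      rw [abs_mul, abs_of_nonpos (hv' x hx), abs_of_nonneg (hu0 x hx)]
      nlinarith [huU x hx, hv' x hx]
    rw [abs_mul]
    have e3 := abs_add_le (u' x * v x) (u x * v' x)
    nlinarith [Real.abs_sin_le_one (F x), abs_nonneg (u' x * v x + u x * v' x)]
  have mono : ∀ f f' : ℝ → ℝ, (∀ x ∈ Set.Icc α β, HasDerivAt f (f' x) x) →
      (∀ x ∈ Set.Icc α β, 0 ≤ f' x) → f α ≤ f β := by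
    intro f f' h h0
    refine monotoneOn_of_deriv_nonneg (convex_Icc α β)
      (fun x hx => (h x hx).continuousAt.continuousWithinAt)
      (fun x hx => (h x (interior_subset hx)).differentiableAt.differentiableWithinAt)
      (fun x hx => ?_) (Set.left_mem_Icc.2 hαβ) (Set.right_mem_Icc.2 hαβ) hαβ
    rw [(h x (interior_subset hx)).deriv]
    exact h0 x (interior_subset hx)
  have m1 := mono _ _ (fun x hx => (hD x hx).add (hP x hx)) (fun x hx => by
    have := abs_le.1 (hbd x hx); linarith)
  have m2 := mono _ _ (fun x hx => (hD x hx).sub (hP x hx)) (fun x hx => by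
    have := abs_le.1 (hbd x hx); linarith)
  simp only [Pi.add_apply, Pi.sub_apply, intervalIntegral.integral_same] at m1 m2
  have hα := Set.left_mem_Icc.2 hαβ
  have hβ := Set.right_mem_Icc.2 hαβ
  have hU : 0 ≤ U := (hu0 α hα).trans (huU α hα)
  have hV : 0 ≤ V := (abs_nonneg _).trans (hvV α hα)
  have w : ∀ x ∈ Set.Icc α β, |Real.sin (F x) * (u x * v x)| ≤ U * V := by
    intro x hx
    rw [abs_mul, abs_mul, abs_of_nonneg (hu0 x hx)]
    have : u x * |v x| ≤ U * V := mul_le_mul (huU x hx) (hvV x hx) (abs_nonneg _) hU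
    have h2 : 0 ≤ u x * |v x| := mul_nonneg (hu0 x hx) (abs_nonneg _)
    nlinarith [Real.abs_sin_le_one (F x)]
  have wα := abs_le.1 (w α hα)
  have wβ := abs_le.1 (w β hβ)
  have q1 : V * u α ≤ U * V := by nlinarith [huU α hα]
  have q2 : 0 ≤ V * u β := mul_nonneg hV (hu0 β hβ)
  have q3 : U * v α ≤ U * V := mul_le_mul_of_nonneg_left (abs_le.1 (hvV α hα)).2 hU
  have q4 : U * (-V) ≤ U * v β := mul_le_mul_of_nonneg_left (abs_le.1 (hvV β hβ)).1 hU
  rw [abs_le]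
  constructor <;> linarith

theorem stmt5 (ξ A B : ℝ) (hξ : 0 < ξ) (hA : 1 < A) (hAB : A < B)
    (m n : ℕ) (hm : 1 ≤ m) (hmn : m < n) (j k : ℕ) (hj : 1 ≤ j) (hk : 1 ≤ k)
    (η : ℝ) (hη : 0 < η) :
    ∃ I₁ I₂ I₃ : Set ℝ,
      I₁ ⊆ Set.Icc A B ∧ I₂ ⊆ Set.Icc A B ∧ I₃ ⊆ Set.Icc A B ∧
      I₁.OrdConnected ∧ I₂.OrdConnected ∧ I₃.OrdConnected ∧
      Disjoint I₁ I₂ ∧ Disjoint I₁ I₃ ∧ Disjoint I₂ I₃ ∧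
      volume (Set.Icc A B \ (I₁ ∪ I₂ ∪ I₃)) ≤ ENNReal.ofReal (2 * B * η) ∧
      ∀ α β : ℝ, α ≤ β →
        (Set.Icc α β ⊆ I₁ ∨ Set.Icc α β ⊆ I₂ ∨ Set.Icc α β ⊆ I₃) →
        |∫ x in α..β, Real.cos (2 * Real.pi * ξ * (j * x ^ n - k * x ^ m))| ≤
          1 / (ξ * η * m * α ^ (m - 1)) := by
  obtain ⟨N, rfl⟩ := Nat.exists_eq_add_of_lt hmn
  obtain ⟨M, rfl⟩ := Nat.exists_eq_add_of_le' hm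
  have hj' : (1:ℝ) ≤ j := by exact_mod_cast hj
  have hk' : (1:ℝ) ≤ k := by exact_mod_cast hk
  have hM : (0:ℝ) < (M + 1 : ℕ) := by positivity
  obtain ⟨r, hr0, hr⟩ : ∃ r : ℝ, 0 < r ∧
      (j:ℝ) * ((M + 1 + N + 1 : ℕ) : ℝ) * r ^ (N + 1) = k * ((M + 1 : ℕ) : ℝ) := by
    have hc : (0:ℝ) < k * ((M + 1 : ℕ) : ℝ) / (j * ((M + 1 + N + 1 : ℕ) : ℝ)) := by positivity
    refine ⟨(k * ((M + 1 : ℕ) : ℝ) / (j * ((M + 1 + N + 1 : ℕ) : ℝ))) ^ (((N + 1 : ℕ) : ℝ)⁻¹),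
      by positivity, ?_⟩
    rw [Real.rpow_inv_natCast_pow hc.le (by omega)]
    field_simp
  have hO : (Set.Icc A B ∩ Set.Iic (r * (1 - η))).OrdConnected :=
    Set.OrdConnected.inter Set.ordConnected_Icc Set.ordConnected_Iic
  have hO2 : (Set.Icc A B ∩ Set.Ici (r * (1 + η))).OrdConnected :=
    Set.OrdConnected.inter Set.ordConnected_Icc Set.ordConnected_Ici
  have hrη : 0 < r * η := by positivity
  refine ⟨Set.Icc A B ∩ Set.Iic (r * (1 - η)), Set.Icc A B ∩ Set.Ici (r * (1 + η)), ∅,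
    Set.inter_subset_left, Set.inter_subset_left, Set.empty_subset _, hO, hO2,
    Set.ordConnected_empty, ?_, by simp, by simp, ?_, ?_⟩
  · rw [Set.disjoint_left]
    rintro x ⟨_, h1⟩ ⟨_, h2⟩
    simp only [Set.mem_Iic, Set.mem_Ici] at h1 h2
    nlinarith
  · have key : ∀ a b : ℝ, b - a ≤ 2 * B * η →
        (∀ x, A ≤ x → x ≤ B → r * (1 - η) < x → x < r * (1 + η) → a ≤ x ∧ x ≤ b) →
        volume (Set.Icc A B \ (Set.Icc A B ∩ Set.Iic (r * (1 - η)) ∪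
          Set.Icc A B ∩ Set.Ici (r * (1 + η)) ∪ ∅)) ≤ ENNReal.ofReal (2 * B * η) := by
      intro a b hab h
      calc _ ≤ volume (Set.Icc a b) := by
            apply measure_mono
            rintro x ⟨hx, hx2⟩
            simp only [Set.union_empty, Set.mem_union, Set.mem_inter_iff, hx, true_and,
              Set.mem_Iic, Set.mem_Ici, not_or, not_le] at hx2
            exact h x hx.1 hx.2 hx2.1 hx2.2
        _ ≤ _ := by
            rw [Real.volume_Icc]
            exact ENNReal.ofReal_le_ofReal hab
    rcases le_total 1 η with h | h
    · exact key A B (by nlinarith) (fun x h1 h2 _ _ => ⟨h1, h2⟩)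
    rcases le_total r B with h3 | h3
    · exact key (r * (1 - η)) (r * (1 + η)) (by nlinarith) (fun x _ _ h1 h2 => ⟨h1.le, h2.le⟩)
    · exact key (B * (1 - η)) B (by nlinarith) (fun x _ h2 h1 _ => ⟨by nlinarith, h2⟩)
  · intro α β hαβ hI
    have hgb : ∀ x ∈ Set.Icc α β, A ≤ x ∧ k * ((M + 1 : ℕ) : ℝ) * η ≤
        |(j:ℝ) * ((M + 1 + N + 1 : ℕ) : ℝ) * x ^ (N + 1) - k * ((M + 1 : ℕ) : ℝ)| := by
      intro x hx
      have hg : (j:ℝ) * ((M + 1 + N + 1 : ℕ) : ℝ) * x ^ (N + 1) - k * ((M + 1 : ℕ) : ℝ)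
          = k * ((M + 1 : ℕ) : ℝ) * ((x / r) ^ (N + 1) - 1) := by
        rw [div_pow, ← hr]; field_simp
      have hkm : (0:ℝ) < k * ((M + 1 : ℕ) : ℝ) := by positivity
      rw [hg, abs_mul, abs_of_pos hkm]
      rcases hI with h | h | h
      · obtain ⟨h1, h2⟩ := h hx
        refine ⟨h1.1, mul_le_mul_of_nonneg_left ?_ hkm.le⟩
        have hx0 : 0 < x := by linarith [h1.1]
        have h3 : x / r ≤ 1 - η := by
          rw [div_le_iff₀ hr0]; rw [mul_comm]; exact h2
        have h4 : (x / r) ^ (N + 1) ≤ x / r :=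
          pow_le_of_le_one (by positivity) (by linarith) (by omega)
        rw [le_abs]; right; linarith
      · obtain ⟨h1, h2⟩ := h hx
        refine ⟨h1.1, mul_le_mul_of_nonneg_left ?_ hkm.le⟩
        have h3 : 1 + η ≤ x / r := by
          rw [le_div_iff₀ hr0]; rw [mul_comm]; exact h2
        have h4 : x / r ≤ (x / r) ^ (N + 1) :=
          le_self_pow₀ (by linarith) (by omega)
        rw [le_abs]; left; linarith
      · exact absurd (h hx) (by simp)
    have hα1 : 0 < α := by linarith [(hgb α (Set.left_mem_Icc.2 hαβ)).1]
    have hpi := Real.pi_pos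
    have hkm : (0:ℝ) < k * ((M + 1 : ℕ) : ℝ) * η := by positivity
    have hx0 : ∀ x ∈ Set.Icc α β, 0 < x := fun x hx => by linarith [hx.1]
    have hg0 : ∀ x ∈ Set.Icc α β,
        (j:ℝ) * ((M + 1 + N + 1 : ℕ) : ℝ) * x ^ (N + 1) - k * ((M + 1 : ℕ) : ℝ) ≠ 0 :=
      fun x hx => abs_pos.1 (hkm.trans_le (hgb x hx).2)
    have main := osc_aux
      (fun x => 2 * Real.pi * ξ * (j * x ^ (M + 1 + N + 1) - k * x ^ (M + 1)))
      (fun x => 2 * Real.pi * ξ * (j * (((M + 1 + N + 1 : ℕ) : ℝ) * x ^ (M + 1 + N)) -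
        k * (((M + 1 : ℕ) : ℝ) * x ^ M)))
      (fun x => (2 * Real.pi * ξ * x ^ M)⁻¹)
      (fun x => -(2 * Real.pi * ξ * ((M:ℝ) * x ^ (M - 1))) / (2 * Real.pi * ξ * x ^ M) ^ 2)
      (fun x => ((j:ℝ) * ((M + 1 + N + 1 : ℕ) : ℝ) * x ^ (N + 1) - k * ((M + 1 : ℕ) : ℝ))⁻¹)
      (fun x => -((j:ℝ) * ((M + 1 + N + 1 : ℕ) : ℝ) * (((N + 1 : ℕ) : ℝ) * x ^ N)) /
        ((j:ℝ) * ((M + 1 + N + 1 : ℕ) : ℝ) * x ^ (N + 1) - k * ((M + 1 : ℕ) : ℝ)) ^ 2)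
      α β (2 * Real.pi * ξ * α ^ M)⁻¹ (k * ((M + 1 : ℕ) : ℝ) * η)⁻¹ hαβ
      (by fun_prop)
      (fun x hx => (((hasDerivAt_pow (M + 1 + N + 1) x).const_mul (j:ℝ)).sub
        ((hasDerivAt_pow (M + 1) x).const_mul (k:ℝ))).const_mul _)
      (fun x hx => ((hasDerivAt_pow M x).const_mul _).fun_inv
        (by have := hx0 x hx; positivity))
      (fun x hx => (((hasDerivAt_pow (N + 1) x).const_mul _).sub_const _).fun_inv (hg0 x hx))
      (fun x hx => by have := hx0 x hx; positivity)
      (fun x hx => by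
        have := hx.1
        apply inv_anti₀ (by positivity)
        gcongr)
      (fun x hx => by
        rw [abs_inv]
        exact inv_anti₀ hkm (hgb x hx).2)
      (fun x hx => by
        have := hx0 x hx
        rw [neg_div]; apply neg_nonpos.2; positivity)
      (fun x hx => by
        have := hx0 x hx
        rw [neg_div]; apply neg_nonpos.2; positivity)
      (fun x hx => by
        have h1 := hx0 x hx
        have h2 := hg0 x hx
        rw [← mul_inv]
        have h3 : 2 * Real.pi * ξ * x ^ M * ((j:ℝ) * ((M + 1 + N + 1 : ℕ) : ℝ) * x ^ (N + 1)
          - k * ((M + 1 : ℕ) : ℝ)) ≠ 0 := mul_ne_zero (by positivity) h2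
        rw [mul_inv_eq_one₀ h3]
        ring)
    refine main.trans ?_
    rw [Nat.add_sub_cancel, ← mul_inv, ← div_eq_mul_inv,
      div_le_div_iff₀ (by positivity) (by positivity)]
    have hQ : 0 < ξ * η * ((M + 1 : ℕ) : ℝ) * α ^ M := by positivity
    have h6 : 5 ≤ 2 * Real.pi * k := by nlinarith [Real.pi_gt_three]
    nlinarith [mul_le_mul_of_nonneg_right h6 hQ.le]
end
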